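/- Let n ≥ 1, let N = e₁ be the first standard basis vector of ℂⁿ, and let S^{2n-1} denote the unit sphere of ℂⁿ. The orbit map θ_N : U(n) → S^{2n-1}, A ↦ A·N, induces a nonzero map on (2n-1)-st singular homology with real coefficients, θ_{N*} : H_{2n-1}(U(n); ℝ) → H_{2n-1}(S^{2n-1}; ℝ) ≅ ℝ. (Hence the transitive U(n)-action on S^{2n-1} admits no homotopy comoment map.) -/

import Mathlib

open CategoryTheory

/-- The singular chain complex functor with real coefficients, defined via the singular
simplicial set. -/
noncomputable def singularChainComplexFunctor : TopCat.{0} ⥤ ChainComplex (ModuleCat.{0} ℝ) ℕ :=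
  TopCat.toSSet ⋙ ((SimplicialObject.whiskering _ _).obj (ModuleCat.free ℝ)) ⋙
    AlgebraicTopology.alternatingFaceMapComplex _

/-- Singular homology with real coefficients, as a functor `TopCat ⥤ ModuleCat ℝ`. -/
noncomputable def singularHomologyFunctor (n : ℕ) : TopCat.{0} ⥤ ModuleCat.{0} ℝ :=
  singularChainComplexFunctor ⋙ HomologicalComplex.homologyFunctor _ _ n

namespace OrbitMapHomology

open MeasureTheory Set

/-- The transposed Jacobian matrix: its `i`-th row is the `i`-th partial derivative. -/
noncomputable def jacobian {k l : ℕ} (h : (Fin k → ℝ) → Fin l → ℝ) (t : Fin k → ℝ) :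
    Matrix (Fin k) (Fin l) ℝ :=
  Matrix.of fun i => fderiv ℝ h t (Pi.single i 1)

/-- The integral over the unit cube of the pullback of the volume form. -/
noncomputable def cubeVolume {k : ℕ} (h : (Fin k → ℝ) → Fin k → ℝ) : ℝ :=
  ∫ t in Icc 0 1, (jacobian h t).det

/-- The integral over the unit cube of the pullback of the primitive `y₀ dy₁ ∧ ⋯ ∧ dyₘ` of the
volume form. -/
noncomputable def cubeFlux {m : ℕ} (h : (Fin m → ℝ) → Fin (m + 1) → ℝ) : ℝ :=
  ∫ t in Icc 0 1, h t 0 * ((jacobian h t).submatrix id Fin.succ).det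

/-- The determinant as a continuous multilinear function of the rows. -/
noncomputable def detRows (k : ℕ) : ContinuousMultilinearMap ℝ (fun _ : Fin k => Fin k → ℝ) ℝ :=
  ⟨Matrix.detRowAlternating.toMultilinearMap,
    Continuous.matrix_det (A := fun v : Fin k → Fin k → ℝ => Matrix.of v) continuous_id⟩

lemma detRows_update_swap {k : ℕ} (v : Fin k → Fin k → ℝ) {i j : Fin k} (hij : i ≠ j)
    (x y : Fin k → ℝ) :
    detRows k (Function.update (Function.update v i x) j y) =
      - detRows k (Function.update (Function.update v j x) i y) := by
  have := Matrix.detRowAlternating.map_swap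
    (Function.update (Function.update v i x) j y : Fin k → Fin k → ℝ) hij
  rw [eq_neg_iff_add_eq_zero]
  have h2 : (Function.update (Function.update v j x) i y) =
      (Function.update (Function.update v i x) j y) ∘ Equiv.swap i j := by
    ext l : 1
    rcases eq_or_ne l i with rfl | hl
    · simp
    rcases eq_or_ne l j with rfl | hl'
    · simp [hij, hij.symm]
    · simp [hl, hl', Equiv.swap_apply_of_ne_of_ne hl hl']
  rw [h2]
  change Matrix.detRowAlternating _ + Matrix.detRowAlternating _ = 0
  rw [this]; ring

lemma hasFDerivAt_partial {k : ℕ} {l : ℕ} {h : (Fin k → ℝ) → Fin l → ℝ} (hh : ContDiff ℝ 2 h)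
    (i : Fin k) (t : Fin k → ℝ) :
    HasFDerivAt (fun t => fderiv ℝ h t (Pi.single i 1))
      ((fderiv ℝ (fderiv ℝ h) t).flip (Pi.single i 1)) t := by
  have h1 : DifferentiableAt ℝ (fderiv ℝ h) t :=
    ((hh.fderiv_right (m := 1) (by norm_num)).differentiable (by norm_num)).differentiableAt
  have := h1.hasFDerivAt.clm_apply (hasFDerivAt_const (Pi.single i (1 : ℝ)) t)
  simpa using this

lemma sum_update_partial_eq_zero {k : ℕ} (v : Fin k → Fin k → ℝ) (e : Fin k → ℝ)
    (w : Fin k → Fin k → Fin k → ℝ) (hw : ∀ i j, w i j = w j i) :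
    ∑ i, ∑ j, detRows k (Function.update (Function.update v i e) j
      (if j = i then 0 else w i j)) = 0 := by
  set T : Fin k → Fin k → ℝ := fun i j => detRows k (Function.update (Function.update v i e) j
      (if j = i then 0 else w i j)) with hT
  have anti : ∀ i j, T i j = - T j i := by
    intro i j
    rcases eq_or_ne i j with rfl | hij
    · have : T i i = 0 := by
        simp only [hT, if_true]
        exact (detRows k).map_coord_zero i (by simp)
      simp [this]
    · simp only [hT, hij, hij.symm, if_false]
      rw [detRows_update_swap _ hij, hw]
  have : ∑ i, ∑ j, T i j = - ∑ i, ∑ j, T i j := by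
    conv_lhs => rw [Finset.sum_comm]
    simp_rw [← Finset.sum_neg_distrib]
    exact Finset.sum_congr rfl fun i _ => Finset.sum_congr rfl fun j _ => anti j i
  change ∑ i, ∑ j, T i j = 0
  linarith

lemma continuous_jacobian {k l : ℕ} {h : (Fin k → ℝ) → Fin l → ℝ} (hh : ContDiff ℝ 1 h) :
    Continuous (jacobian h) := by
  refine continuous_pi fun i => ?_
  exact (hh.continuous_fderiv (by norm_num)).clm_apply continuous_const

lemma jacobian_comp_insertNth {m l : ℕ} {h : (Fin (m + 1) → ℝ) → Fin l → ℝ}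
    (hh : Differentiable ℝ h) (i : Fin (m + 1)) (c : ℝ) (t : Fin m → ℝ) :
    jacobian (fun s => h (i.insertNth c s)) t =
      (jacobian h (i.insertNth c t)).submatrix i.succAbove id := by
  have hL : HasFDerivAt (fun s : Fin m → ℝ => (i.insertNth c s : Fin (m + 1) → ℝ))
      (ContinuousLinearMap.pi
        (i.insertNth (0 : (Fin m → ℝ) →L[ℝ] ℝ) (fun j => ContinuousLinearMap.proj j))) t := by
    rw [hasFDerivAt_pi']
    intro j
    refine Fin.succAboveCases i ?_ (fun j => ?_) j
    · have := hasFDerivAt_const (𝕜 := ℝ) c t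
      convert! this using 1
      · simp
      · ext; simp
    · have := hasFDerivAt_apply (𝕜 := ℝ) j t
      convert! this using 1
      · simp
      · ext; simp
  have hc := (hh (i.insertNth c t)).hasFDerivAt.comp t hL
  have hsingle : ∀ j : Fin m, ContinuousLinearMap.pi
      (i.insertNth (0 : (Fin m → ℝ) →L[ℝ] ℝ) (fun j => ContinuousLinearMap.proj j))
      (Pi.single j (1 : ℝ)) = (Pi.single (i.succAbove j) 1 : Fin (m + 1) → ℝ) := by
    intro j
    ext a
    refine Fin.succAboveCases i ?_ (fun a => ?_) a
    · simp
    · simp [Pi.single_apply]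
  ext j b
  have h3 : fderiv ℝ (fun s => h (i.insertNth c s)) t = _ := hc.fderiv
  simp only [jacobian, Matrix.of_apply, Matrix.submatrix_apply, id, h3,
    ContinuousLinearMap.comp_apply, hsingle]

/-- The Stokes theorem for the volume form pulled back to a cube. -/
theorem cubeVolume_eq_sum_cubeFlux {m : ℕ} {h : (Fin (m + 1) → ℝ) → Fin (m + 1) → ℝ}
    (hh : ContDiff ℝ 2 h) :
    cubeVolume h = ∑ i : Fin (m + 1), (-1) ^ (i : ℕ) *
      (cubeFlux (fun t => h (i.insertNth 1 t)) - cubeFlux (fun t => h (i.insertNth 0 t))) := by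
  set e : Fin (m + 1) → ℝ := Pi.single 0 1
  set v : Fin (m + 1) → (Fin (m + 1) → ℝ) → Fin (m + 1) → ℝ :=
    fun l t => fderiv ℝ h t (Pi.single l 1) with hv
  set D := fun t => fderiv ℝ (fderiv ℝ h) t
  have hd1 : Differentiable ℝ h := hh.differentiable (by norm_num)
  have hadj : ∀ i t, detRows _ (Function.update (fun l => v l t) i e) =
      (jacobian h t).adjugate 0 i := by
    intro i t; rw [Matrix.adjugate_apply]; rfl
  have hrow : ∀ i l t, HasFDerivAt (fun t => Function.update (fun l => v l t) i e l)
      (if l = i then 0 else (D t).flip (Pi.single l 1)) t := by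
    intro i l t
    rcases eq_or_ne l i with rfl | hl
    · simpa using hasFDerivAt_const (𝕜 := ℝ) e t
    · simpa [hl] using hasFDerivAt_partial hh l t
  set g' : Fin (m + 1) → (Fin (m + 1) → ℝ) → (Fin (m + 1) → ℝ) →L[ℝ] ℝ := fun i t =>
    ∑ l, ((detRows (m + 1)).toContinuousLinearMap (Function.update (fun l => v l t) i e) l) ∘L
      (if l = i then 0 else (D t).flip (Pi.single l 1))
  have hg : ∀ i t, HasFDerivAt
      (fun t => detRows (m + 1) (Function.update (fun l => v l t) i e)) (g' i t) t := by
    intro i t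
    exact HasFDerivAt.multilinear_comp (detRows (m + 1)) (fun l => hrow i l t)
  have hh0 : ∀ t, HasFDerivAt (fun t => h t 0)
      ((ContinuousLinearMap.proj (R := ℝ) (φ := fun _ : Fin (m+1) => ℝ) 0) ∘L fderiv ℝ h t) t :=
    fun t => (hasFDerivAt_pi'.1 (hd1 t).hasFDerivAt) 0
  have hf := fun i t => (hh0 t).mul (hg i t)
  have hdiv : ∀ t, (jacobian h t).det = ∑ i, (h t 0 • g' i t +
      (detRows (m + 1) (Function.update (fun l => v l t) i e)) •
      ((ContinuousLinearMap.proj (R := ℝ) (φ := fun _ : Fin (m+1) => ℝ) 0) ∘L fderiv ℝ h t))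
        (Pi.single i 1) := by
    intro t
    have hsym : ∀ a b, D t a b = D t b a := by
      intro a b
      exact (hh.contDiffAt (x := t)).isSymmSndFDerivAt (by simp) a b
    have h0 := sum_update_partial_eq_zero (fun l => v l t) e
      (fun i j => D t (Pi.single i 1) (Pi.single j 1)) (fun i j => hsym _ _)
    have h1 : ∑ i, g' i t (Pi.single i 1) = 0 := by
      rw [← h0]
      refine Finset.sum_congr rfl fun i _ => ?_
      simp only [g', _root_.sum_apply, ContinuousLinearMap.comp_apply]
      refine Finset.sum_congr rfl fun l _ => ?_
      split_ifs with hl <;> rfl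
    simp only [_root_.add_apply, _root_.smul_apply, smul_eq_mul,
      Finset.sum_add_distrib, ← Finset.mul_sum, h1, mul_zero, zero_add]
    rw [Matrix.det_eq_sum_mul_adjugate_col _ 0]
    refine Finset.sum_congr rfl fun i _ => ?_
    rw [hadj, mul_comm]; rfl
  have hcont : ∀ i, Continuous
      (fun t => h t 0 * detRows (m + 1) (Function.update (fun l => v l t) i e)) := fun i =>
    continuous_iff_continuousAt.2 fun t => (hf i t).continuousAt
  have hjac := (continuous_jacobian (hh.of_le (by norm_num : (1 : WithTop ℕ∞) ≤ 2))).matrix_det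
  have key := integral_divergence_of_hasFDerivAt_off_countable' (0 : Fin (m + 1) → ℝ) 1
    (by intro i; simp)
    (fun i t => h t 0 * detRows (m + 1) (Function.update (fun l => v l t) i e))
    _ ∅ countable_empty (fun i => (hcont i).continuousOn) (fun t _ i => hf i t)
    (by
      simp_rw [← hdiv]
      exact hjac.continuousOn.integrableOn_compact isCompact_Icc)
  simp_rw [← hdiv] at key
  rw [cubeVolume, key]
  refine Finset.sum_congr rfl fun i _ => ?_
  have hface : ∀ c t, h (i.insertNth c t) 0 *
      detRows (m + 1) (Function.update (fun l => v l (i.insertNth c t)) i e) =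
      (-1) ^ (i : ℕ) * (h (i.insertNth c t) 0 *
        ((jacobian (fun s => h (i.insertNth c s)) t).submatrix id Fin.succ).det) := by
    intro c t
    rw [hadj, Matrix.adjugate_fin_succ_eq_det_submatrix, jacobian_comp_insertNth hd1]
    simp only [Fin.val_zero, add_zero, Matrix.submatrix_submatrix]
    rw [show (0 : Fin (m + 1)).succAbove = Fin.succ from by ext; simp]
    simp only [Function.comp_id, Function.id_comp]
    ring
  simp only [hface, integral_const_mul, cubeFlux, mul_sub, Pi.one_apply, Pi.zero_apply]
  rfl

lemma cubeFlux_eq_zero_of_const {m : ℕ} {h : (Fin m → ℝ) → Fin (m + 1) → ℝ} (j : Fin m)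
    (hh : Differentiable ℝ h) (hj : ∀ t (c : ℝ), h (t + Pi.single j c) = h t) :
    cubeFlux h = 0 := by
  have : ∀ t, ((jacobian h t).submatrix id Fin.succ).det = 0 := by
    intro t
    refine Matrix.det_eq_zero_of_row_eq_zero j fun c => ?_
    have h1 : HasDerivAt (fun s : ℝ => h (t + s • Pi.single j 1))
        (fderiv ℝ h t (Pi.single j 1)) 0 := by
      have := (hh t).hasFDerivAt.hasLineDerivAt (Pi.single j 1)
      exact this
    have h2 : (fun s : ℝ => h (t + s • Pi.single j 1)) = fun _ => h t := by
      funext s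
      rw [← hj t s]; congr; ext i; simp [Pi.single_apply]
    rw [h2] at h1
    have := h1.unique (hasDerivAt_const 0 (h t))
    simp [jacobian, this]
  simp [cubeFlux, this]

/-- The point `ν / N` of the unit cube. -/
noncomputable def gridPoint {k N : ℕ} (ν : Fin k → Fin (N + 1)) : Fin k → ℝ :=
  fun j => (ν j : ℝ) / N

/-- The multivariate Bernstein weights. -/
noncomputable def bernsteinWeight {k N : ℕ} (t : Fin k → ℝ) (ν : Fin k → Fin (N + 1)) : ℝ :=
  ∏ j, (bernsteinPolynomial ℝ N (ν j)).eval (t j)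

/-- The multivariate Bernstein approximation of a function on the unit cube. -/
noncomputable def bernsteinOp {k : ℕ} {E : Type*} [AddCommGroup E] [Module ℝ E] (N : ℕ)
    (φ : (Fin k → ℝ) → E) (t : Fin k → ℝ) : E :=
  ∑ ν : Fin k → Fin (N + 1), bernsteinWeight t ν • φ (gridPoint ν)

lemma gridPoint_mem {k N : ℕ} (ν : Fin k → Fin (N + 1)) : gridPoint ν ∈ Icc (0 : Fin k → ℝ) 1 := by
  refine ⟨fun j => ?_, fun j => ?_⟩
  · simp only [gridPoint, Pi.zero_apply]; positivity
  · have : ((ν j : ℕ) : ℝ) ≤ N := by exact_mod_cast Nat.lt_succ_iff.1 (ν j).2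
    exact div_le_one_of_le₀ this (by positivity)

lemma bernsteinOp_congr {k : ℕ} {E : Type*} [AddCommGroup E] [Module ℝ E] (N : ℕ)
    {φ ψ : (Fin k → ℝ) → E} (h : EqOn φ ψ (Icc 0 1)) : bernsteinOp N φ = bernsteinOp N ψ := by
  funext t
  exact Finset.sum_congr rfl fun ν _ => by rw [h (gridPoint_mem ν)]

lemma contDiff_eval (p : Polynomial ℝ) {n : WithTop ℕ∞} :
    ContDiff ℝ n (fun x : ℝ => p.eval x) := by
  simpa using Polynomial.contDiff_aeval (𝕜 := ℝ) p n

lemma contDiff_bernsteinWeight {k N : ℕ} (ν : Fin k → Fin (N + 1)) {n : WithTop ℕ∞} :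
    ContDiff ℝ n (fun t => bernsteinWeight t ν) := by
  refine contDiff_prod fun j _ => ?_
  exact (contDiff_eval _).comp (contDiff_apply ℝ ℝ j)

lemma contDiff_bernsteinOp {k : ℕ} {E : Type*} [NormedAddCommGroup E] [NormedSpace ℝ E] (N : ℕ)
    (φ : (Fin k → ℝ) → E) {n : WithTop ℕ∞} : ContDiff ℝ n (bernsteinOp N φ) :=
  ContDiff.sum fun ν _ => (contDiff_bernsteinWeight ν).smul contDiff_const

lemma sum_bernsteinWeight_mul_prod {k N : ℕ} (t : Fin k → ℝ) (f : Fin k → Fin (N + 1) → ℝ) :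
    ∑ ν, bernsteinWeight t ν * ∏ j, f j (ν j) =
      ∏ j, ∑ n : Fin (N + 1), (bernsteinPolynomial ℝ N n).eval (t j) * f j n := by
  simp_rw [bernsteinWeight, ← Finset.prod_mul_distrib]
  exact (Fintype.prod_sum fun j (n : Fin (N + 1)) =>
    (bernsteinPolynomial ℝ N n).eval (t j) * f j n).symm

lemma sum_eval_bernsteinPolynomial (N : ℕ) (x : ℝ) :
    ∑ n : Fin (N + 1), (bernsteinPolynomial ℝ N n).eval x = 1 := by
  have := congrArg (Polynomial.eval x) (bernsteinPolynomial.sum ℝ N)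
  rw [Polynomial.eval_finsetSum, Finset.sum_range] at this
  simpa using this

lemma sum_bernsteinWeight {k N : ℕ} (t : Fin k → ℝ) :
    ∑ ν : Fin k → Fin (N + 1), bernsteinWeight t ν = 1 := by
  have := sum_bernsteinWeight_mul_prod (N := N) t (fun _ _ => 1)
  simpa [sum_eval_bernsteinPolynomial] using this

lemma bernsteinWeight_nonneg {k N : ℕ} {t : Fin k → ℝ} (ht : t ∈ Icc (0 : Fin k → ℝ) 1)
    (ν : Fin k → Fin (N + 1)) : 0 ≤ bernsteinWeight t ν := by
  refine Finset.prod_nonneg fun j _ => ?_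
  have h0 := ht.1 j
  have h1 := ht.2 j
  simp only [Pi.zero_apply, Pi.one_apply] at h0 h1
  have : 0 ≤ 1 - t j := by linarith
  simp only [bernsteinPolynomial, Polynomial.eval_mul, Polynomial.eval_pow, Polynomial.eval_sub,
    Polynomial.eval_X, Polynomial.eval_one, Polynomial.eval_natCast]
  positivity

lemma sum_sq_mul_eval_bernsteinPolynomial {N : ℕ} (hN : N ≠ 0) (x : ℝ) :
    ∑ n : Fin (N + 1), (bernsteinPolynomial ℝ N n).eval x * ((n : ℝ) / N - x) ^ 2 =
      x * (1 - x) / N := by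
  have := congrArg (Polynomial.eval x) (bernsteinPolynomial.variance ℝ N)
  rw [Polynomial.eval_finsetSum, Finset.sum_range] at this
  simp only [Polynomial.eval_mul, Polynomial.eval_pow, Polynomial.eval_sub, Polynomial.eval_X,
    Polynomial.eval_one, Polynomial.eval_natCast, nsmul_eq_mul] at this
  have hN' : (N : ℝ) ≠ 0 := by exact_mod_cast hN
  have h2 : x * (1 - x) / N = (N * x * (1 - x)) / N ^ 2 := by field_simp
  rw [h2, ← this, Finset.sum_div]
  refine Finset.sum_congr rfl fun n _ => ?_
  field_simp
  ring

lemma sum_bernsteinWeight_mul_sq {k N : ℕ} (hN : N ≠ 0) (t : Fin k → ℝ) (i : Fin k) :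
    ∑ ν : Fin k → Fin (N + 1), bernsteinWeight t ν * (gridPoint ν i - t i) ^ 2 =
      t i * (1 - t i) / N := by
  have := sum_bernsteinWeight_mul_prod (N := N) t
    (fun j n => if j = i then ((n : ℝ) / N - t j) ^ 2 else 1)
  simp only [Finset.prod_ite_eq', Finset.mem_univ, if_true] at this
  rw [show (∑ ν : Fin k → Fin (N + 1), bernsteinWeight t ν * (gridPoint ν i - t i) ^ 2) = _
    from this]
  rw [Finset.prod_eq_single i]
  · simpa using sum_sq_mul_eval_bernsteinPolynomial hN (t i)
  · intro j _ hj
    simp [hj, sum_eval_bernsteinPolynomial]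
  · simp

theorem tendstoUniformlyOn_bernsteinOp {k : ℕ} {E : Type*} [NormedAddCommGroup E] [NormedSpace ℝ E]
    {φ : (Fin k → ℝ) → E} (hφ : ContinuousOn φ (Icc 0 1)) {ε : ℝ} (hε : 0 < ε) :
    ∀ᶠ N in Filter.atTop, ∀ t ∈ Icc (0 : Fin k → ℝ) 1, ‖bernsteinOp N φ t - φ t‖ < ε := by
  obtain ⟨M, hM⟩ := isCompact_Icc.exists_bound_of_continuousOn hφ
  have huc := Metric.uniformContinuousOn_iff.1
    (isCompact_Icc.uniformContinuousOn_of_continuous hφ) (ε / 2) (by positivity)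
  obtain ⟨δ, hδ, hδ'⟩ := huc
  have hM0 : 0 ≤ M := (norm_nonneg _).trans (hM 0 (by simp))
  set C := 2 * M / δ ^ 2
  have hC : 0 ≤ C := by positivity
  have hpt : ∀ x ∈ Icc (0 : Fin k → ℝ) 1, ∀ t ∈ Icc (0 : Fin k → ℝ) 1,
      ‖φ x - φ t‖ ≤ ε / 2 + C * ∑ j, (x j - t j) ^ 2 := by
    intro x hx t ht
    have hs : 0 ≤ C * ∑ j, (x j - t j) ^ 2 := by positivity
    by_cases h : dist x t < δ
    · have := hδ' x hx t ht h
      rw [dist_eq_norm] at this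
      linarith
    · have : ∃ j, δ ≤ |x j - t j| := by
        by_contra! hcon
        exact h ((dist_pi_lt_iff hδ).2 hcon)
      obtain ⟨j, hj⟩ := this
      have h1 : δ ^ 2 ≤ ∑ j, (x j - t j) ^ 2 := by
        calc δ ^ 2 ≤ |x j - t j| ^ 2 := by gcongr
          _ = (x j - t j) ^ 2 := sq_abs _
          _ ≤ _ := Finset.single_le_sum (f := fun j => (x j - t j) ^ 2)
            (fun _ _ => sq_nonneg _) (Finset.mem_univ j)
      have h2 : 2 * M ≤ C * ∑ j, (x j - t j) ^ 2 := by
        calc 2 * M = C * δ ^ 2 := by simp only [C]; field_simp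
          _ ≤ _ := by gcongr
      have h3 := norm_sub_le (φ x) (φ t)
      linarith [hM x hx, hM t ht]
  have hlim : Filter.Tendsto (fun N : ℕ => C * (k * (1 / (N : ℝ)))) Filter.atTop (nhds 0) := by
    have := tendsto_one_div_atTop_nhds_zero_nat (𝕜 := ℝ)
    simpa using (this.const_mul (k : ℝ)).const_mul C
  filter_upwards [hlim.eventually (gt_mem_nhds (half_pos hε)), Filter.eventually_ne_atTop 0]
    with N hN hN0 t ht
  have hNpos : (0 : ℝ) < N := by positivity
  have e1 : bernsteinOp N φ t - φ t =
      ∑ ν : Fin k → Fin (N + 1), bernsteinWeight t ν • (φ (gridPoint ν) - φ t) := by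
    simp only [smul_sub, Finset.sum_sub_distrib, ← Finset.sum_smul, sum_bernsteinWeight, one_smul]
    rfl
  rw [e1]
  calc _ ≤ ∑ ν : Fin k → Fin (N + 1),
        bernsteinWeight t ν * (ε / 2 + C * ∑ j, (gridPoint ν j - t j) ^ 2) := by
        refine (norm_sum_le _ _).trans (Finset.sum_le_sum fun ν _ => ?_)
        rw [norm_smul, Real.norm_of_nonneg (bernsteinWeight_nonneg ht ν)]
        exact mul_le_mul_of_nonneg_left (hpt _ (gridPoint_mem ν) _ ht)
          (bernsteinWeight_nonneg ht ν)
    _ = ε / 2 + C * ∑ j, ∑ ν : Fin k → Fin (N + 1),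
          bernsteinWeight t ν * (gridPoint ν j - t j) ^ 2 := by
        simp only [mul_add, Finset.sum_add_distrib, ← Finset.sum_mul, sum_bernsteinWeight, one_mul]
        rw [Finset.sum_comm, Finset.mul_sum]
        congr 1
        refine Finset.sum_congr rfl fun ν _ => ?_
        rw [Finset.mul_sum, Finset.mul_sum, Finset.mul_sum]
        exact Finset.sum_congr rfl fun j _ => by ring
    _ ≤ ε / 2 + C * (k * (1 / N)) := by
        simp only [sum_bernsteinWeight_mul_sq hN0]
        gcongr
        refine (Finset.sum_le_card_nsmul _ _ (1 / (N : ℝ)) fun j _ => ?_).trans (by simp)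
        gcongr
        have h0 := ht.1 j
        have h1 := ht.2 j
        simp only [Pi.zero_apply, Pi.one_apply] at h0 h1
        nlinarith
    _ < ε := by linarith

lemma bernsteinWeight_insertNth {k N : ℕ} (i : Fin (k + 1)) (c : ℝ) (t : Fin k → ℝ)
    (n : Fin (N + 1)) (ν : Fin k → Fin (N + 1)) :
    bernsteinWeight (i.insertNth c t : Fin (k + 1) → ℝ) (i.insertNth n ν) =
      (bernsteinPolynomial ℝ N n).eval c * bernsteinWeight t ν := by
  simp [bernsteinWeight, Fin.prod_univ_succAbove _ i]

lemma gridPoint_insertNth {k N : ℕ} (i : Fin (k + 1)) (n : Fin (N + 1))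
    (ν : Fin k → Fin (N + 1)) :
    gridPoint (i.insertNth n ν) = (i.insertNth ((n : ℝ) / N) (gridPoint ν) : Fin (k + 1) → ℝ) := by
  funext a
  refine Fin.succAboveCases i ?_ (fun a => ?_) a <;> simp [gridPoint]

lemma bernsteinOp_insertNth {k : ℕ} {E : Type*} [AddCommGroup E] [Module ℝ E] (N : ℕ)
    (φ : (Fin (k + 1) → ℝ) → E) (i : Fin (k + 1)) (c : ℝ) (t : Fin k → ℝ) :
    bernsteinOp N φ (i.insertNth c t) = ∑ n : Fin (N + 1), (bernsteinPolynomial ℝ N n).eval c •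
      bernsteinOp N (fun s => φ (i.insertNth ((n : ℝ) / N) s)) t := by
  rw [bernsteinOp, ← (Fin.insertNthEquiv (fun _ => Fin (N + 1)) i).sum_comp,
    Fintype.sum_prod_type]
  refine Finset.sum_congr rfl fun n _ => ?_
  rw [bernsteinOp, Finset.smul_sum]
  refine Finset.sum_congr rfl fun ν _ => ?_
  change bernsteinWeight _ (i.insertNth n ν) • φ (gridPoint (i.insertNth n ν)) = _
  rw [gridPoint_insertNth, bernsteinWeight_insertNth, mul_smul]

lemma bernsteinOp_insertNth_zero {k : ℕ} {E : Type*} [AddCommGroup E] [Module ℝ E] (N : ℕ)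
    (φ : (Fin (k + 1) → ℝ) → E) (i : Fin (k + 1)) (t : Fin k → ℝ) :
    bernsteinOp N φ (i.insertNth 0 t) = bernsteinOp N (fun s => φ (i.insertNth 0 s)) t := by
  rw [bernsteinOp_insertNth, Finset.sum_eq_single 0]
  · simp [bernsteinPolynomial.eval_at_0]
  · intro n _ hn
    have : (n : ℕ) ≠ 0 := fun h => hn (Fin.ext h)
    simp [bernsteinPolynomial.eval_at_0, this]
  · simp

lemma bernsteinOp_insertNth_one {k : ℕ} {E : Type*} [AddCommGroup E] [Module ℝ E] {N : ℕ}
    (hN : N ≠ 0) (φ : (Fin (k + 1) → ℝ) → E) (i : Fin (k + 1)) (t : Fin k → ℝ) :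
    bernsteinOp N φ (i.insertNth 1 t) = bernsteinOp N (fun s => φ (i.insertNth 1 s)) t := by
  have hN' : (N : ℝ) ≠ 0 := by exact_mod_cast hN
  rw [bernsteinOp_insertNth, Finset.sum_eq_single (Fin.last N)]
  · simp [bernsteinPolynomial.eval_at_1, hN']
  · intro n _ hn
    have : (n : ℕ) ≠ N := fun h => hn (Fin.ext h)
    simp [bernsteinPolynomial.eval_at_1, this]
  · simp

lemma bernsteinOp_add_single {k : ℕ} {E : Type*} [AddCommGroup E] [Module ℝ E] (N : ℕ)
    {φ : (Fin (k + 1) → ℝ) → E} (i : Fin (k + 1))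
    (hφ : ∀ (c c' : ℝ) (s : Fin k → ℝ), φ (i.insertNth c s) = φ (i.insertNth c' s))
    (t : Fin (k + 1) → ℝ) (c : ℝ) :
    bernsteinOp N φ (t + Pi.single i c) = bernsteinOp N φ t := by
  have key : ∀ c s, bernsteinOp N φ (i.insertNth c s) =
      bernsteinOp N (fun s => φ (i.insertNth 0 s)) s := by
    intro c s
    rw [bernsteinOp_insertNth]
    have : ∀ n : Fin (N + 1), (fun s => φ (i.insertNth ((n : ℝ) / N) s)) =
        fun s => φ (i.insertNth 0 s) := fun n => funext fun s => hφ _ _ _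
    simp only [this, ← Finset.sum_smul, sum_eval_bernsteinPolynomial, one_smul]
  have h1 : t + Pi.single i c = i.insertNth (t i + c) (i.removeNth t) := by
    funext a
    refine Fin.succAboveCases i ?_ (fun a => ?_) a <;> simp [Fin.removeNth]
  have h2 : t = i.insertNth (t i) (i.removeNth t) := by simp
  rw [h1, key]
  conv_rhs => rw [h2, key]

open Polynomial in
lemma exists_moment_polynomial (a : ℕ) : ∃ Q : ℝ[X][X], Q.map (evalRingHom 0) = X ^ a ∧
    ∀ N : ℕ, N ≠ 0 → ∑ n : Fin (N + 1), C (((n : ℝ) / N) ^ a) * bernsteinPolynomial ℝ N n =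
      Q.map (evalRingHom (1 / (N : ℝ))) := by
  induction a with
  | zero =>
    refine ⟨1, by simp, fun N hN => ?_⟩
    have := bernsteinPolynomial.sum ℝ N
    rw [Finset.sum_range] at this
    simpa using this
  | succ a ih =>
    obtain ⟨Q, h0, hQ⟩ := ih
    refine ⟨X * Q + C X * (X * (1 - X)) * derivative Q, ?_, fun N hN => ?_⟩
    · simp [h0, pow_succ']
    · have hb : ∀ n : Fin (N + 1), X * (1 - X) * derivative (bernsteinPolynomial ℝ N n) =
          (C (n : ℝ) - C (N : ℝ) * X) * bernsteinPolynomial ℝ N n := by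
        intro n
        obtain ⟨r, hr⟩ := Nat.exists_eq_add_of_le (Nat.lt_succ_iff.1 n.2)
        generalize (n : ℕ) = n' at hr
        subst hr
        simp only [bernsteinPolynomial, derivative_mul, derivative_natCast, derivative_pow,
          derivative_sub, derivative_one, derivative_X, add_tsub_cancel_left]
        rcases n' with _ | n' <;> rcases r with _ | r <;> simp [pow_succ] <;> ring
      have hN' : (N : ℝ) ≠ 0 := by exact_mod_cast hN
      have hd := congrArg derivative (hQ N hN)
      rw [derivative_sum, derivative_map] at hd
      simp only [Polynomial.map_add, Polynomial.map_mul, map_X, ← hQ N hN, ← hd, map_C,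
        Polynomial.map_sub, Polynomial.map_one, Finset.mul_sum, ← Finset.sum_add_distrib,
        derivative_mul, derivative_C, zero_mul, zero_add]
      refine Finset.sum_congr rfl fun n _ => ?_
      have e : (C ((evalRingHom (1 / (N : ℝ))) X) : ℝ[X]) * (X * (1 - X)) *
          (C (((n : ℝ) / N) ^ a) * derivative (bernsteinPolynomial ℝ N n)) =
          C (1 / (N : ℝ)) * C (((n : ℝ) / N) ^ a) *
            (X * (1 - X) * derivative (bernsteinPolynomial ℝ N n)) := by
        simp only [coe_evalRingHom, eval_X]; ring
      rw [e, hb]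
      have e2 : (C ((n : ℝ) / N) : ℝ[X]) = C (1 / (N : ℝ)) * C (n : ℝ) := by
        rw [← C_mul]; congr 1; ring
      have e3 : (C (1 / (N : ℝ)) : ℝ[X]) * C (N : ℝ) = 1 := by
        rw [← C_mul, one_div_mul_cancel hN', C_1]
      rw [pow_succ, C_mul, e2]
      linear_combination ((C (((n : ℝ) / N) ^ a) * X * bernsteinPolynomial ℝ N n)) * e3

open Polynomial in
lemma contDiff_eval_map_evalRingHom (Q : ℝ[X][X]) {n : WithTop ℕ∞} :
    ContDiff ℝ n (fun p : ℝ × ℝ => (Q.map (evalRingHom p.1)).eval p.2) := by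
  induction Q using Polynomial.induction_on' with
  | add P Q hP hQ => simpa using hP.add hQ
  | monomial a q =>
    simp only [map_monomial, eval_monomial, coe_evalRingHom]
    exact ((contDiff_eval q).comp contDiff_fst).mul (contDiff_snd.pow a)

/-- The Bernstein approximations of a polynomial are the values at `ε = 1 / N` of a family
depending smoothly on the parameter `ε`, with value the original polynomial at `ε = 0`. -/
theorem exists_contDiff_bernsteinOp_eval {k : ℕ} (p : MvPolynomial (Fin k) ℝ) :
    ∃ Φ : ℝ × (Fin k → ℝ) → ℝ, (∀ n : WithTop ℕ∞, ContDiff ℝ n Φ) ∧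
      (∀ t, Φ (0, t) = MvPolynomial.eval t p) ∧ ∀ N : ℕ, N ≠ 0 → ∀ t,
        Φ (1 / N, t) = bernsteinOp N (fun s => MvPolynomial.eval s p) t := by
  induction p using MvPolynomial.induction_on' with
  | add p q hp hq =>
    obtain ⟨Φ, h1, h2, h3⟩ := hp
    obtain ⟨Ψ, k1, k2, k3⟩ := hq
    refine ⟨Φ + Ψ, fun n => (h1 n).add (k1 n), fun t => by simp [h2, k2], fun N hN t => ?_⟩
    rw [Pi.add_apply, h3 N hN, k3 N hN]
    simp [bernsteinOp, mul_add, Finset.sum_add_distrib]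
  | monomial a c =>
    choose Q hQ0 hQ using exists_moment_polynomial
    refine ⟨fun p => c * ∏ j, ((Q (a j)).map (Polynomial.evalRingHom p.1)).eval (p.2 j), ?_, ?_, ?_⟩
    · intro n
      refine contDiff_const.mul (contDiff_prod fun j _ => ?_)
      exact (contDiff_eval_map_evalRingHom (Q (a j))).comp
        (contDiff_fst.prodMk ((contDiff_apply ℝ ℝ j).comp contDiff_snd))
    · intro t
      simp only [hQ0]
      simp [MvPolynomial.eval_monomial, Finsupp.prod_fintype]
    · intro N hN t
      simp only [← hQ _ N hN, Polynomial.eval_finsetSum, Polynomial.eval_mul, Polynomial.eval_C]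
      have := sum_bernsteinWeight_mul_prod (N := N) t (fun j n => ((n : ℝ) / N) ^ a j)
      simp only [mul_comm (Polynomial.eval _ _)] at this
      rw [← this, bernsteinOp, Finset.mul_sum]
      refine Finset.sum_congr rfl fun ν _ => ?_
      simp only [MvPolynomial.eval_monomial, smul_eq_mul, gridPoint]
      rw [Finsupp.prod_fintype _ _ (by simp)]
      ring

/-- The Duffy parametrization of the standard simplex by the cube, in barycentric coordinates. -/
def duffy : ∀ k : ℕ, (Fin k → ℝ) → Fin (k + 1) → ℝ
  | 0, _ => fun _ => 1
  | k + 1, t => Fin.cons (1 - t 0) (t 0 • duffy k (Fin.tail t))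

lemma duffy_succ (k : ℕ) (t : Fin (k + 1) → ℝ) :
    duffy (k + 1) t = Fin.cons (1 - t 0) (t 0 • duffy k (Fin.tail t)) := rfl

lemma continuous_duffy (k : ℕ) : Continuous (duffy k) := by
  induction k with
  | zero => exact continuous_const
  | succ k ih =>
    refine continuous_pi fun i => Fin.cases ?_ (fun i => ?_) i
    · simp only [duffy_succ, Fin.cons_zero]; fun_prop
    · simp only [duffy_succ, Fin.cons_succ, Pi.smul_apply, smul_eq_mul]
      have : Continuous fun t : Fin (k + 1) → ℝ => duffy k (Fin.tail t) :=
        ih.comp (continuous_pi fun i => continuous_apply _)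
      exact (continuous_apply 0).mul ((continuous_apply i).comp this)

lemma sum_duffy (k : ℕ) (t : Fin k → ℝ) : ∑ i, duffy k t i = 1 := by
  induction k with
  | zero => simp [duffy]
  | succ k ih => simp [duffy_succ, Fin.sum_univ_succ (n := k + 1), ← Finset.mul_sum, ih]

lemma duffy_nonneg (k : ℕ) {t : Fin k → ℝ} (ht : t ∈ Icc (0 : Fin k → ℝ) 1) (i : Fin (k + 1)) :
    0 ≤ duffy k t i := by
  induction k with
  | zero => simp [duffy]
  | succ k ih =>
    have h0 := ht.1 0
    have h1 := ht.2 0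
    simp only [Pi.zero_apply, Pi.one_apply] at h0 h1
    refine Fin.cases ?_ (fun i => ?_) i
    · simpa [duffy_succ] using h1
    · simp only [duffy_succ, Fin.cons_succ, Pi.smul_apply, smul_eq_mul]
      exact mul_nonneg h0 (ih ⟨fun j => ht.1 j.succ, fun j => ht.2 j.succ⟩ i)

lemma duffy_cons (k : ℕ) (a : ℝ) (t : Fin k → ℝ) :
    duffy (k + 1) (Fin.cons a t) = Fin.cons (1 - a) (a • duffy k t) := by
  rw [duffy_succ, Fin.cons_zero, Fin.tail_cons]

lemma insertNth_succ_eq_cons {k : ℕ} (i : Fin (k + 1)) (c : ℝ) (t : Fin (k + 1) → ℝ) :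
    (i.succ.insertNth c t : Fin (k + 2) → ℝ) = Fin.cons (t 0) (i.insertNth c (Fin.tail t)) := by
  conv_lhs => rw [← Fin.cons_self_tail t]
  rw [Fin.insertNth_succ_cons]

lemma smul_insertNth_zero {k : ℕ} (i : Fin (k + 1)) (a : ℝ) (x : Fin k → ℝ) :
    a • (i.insertNth 0 x : Fin (k + 1) → ℝ) = i.insertNth 0 (a • x) := by
  funext b
  refine Fin.succAboveCases i ?_ (fun b => ?_) b <;> simp

lemma duffy_insertNth_one (k : ℕ) (i : Fin (k + 1)) (t : Fin k → ℝ) :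
    duffy (k + 1) (i.insertNth 1 t) = (i.castSucc.insertNth 0 (duffy k t) : Fin (k + 2) → ℝ) := by
  induction k with
  | zero =>
    obtain rfl : i = 0 := by ext; simp
    simp [Fin.insertNth_zero', duffy_cons]
  | succ k ih =>
    refine Fin.cases ?_ (fun i => ?_) i
    · simp [Fin.insertNth_zero', duffy_cons]
    · rw [insertNth_succ_eq_cons, duffy_cons, ih, smul_insertNth_zero, duffy_succ,
        ← Fin.succ_castSucc, Fin.insertNth_succ_cons]

lemma duffy_insertNth_last_zero (k : ℕ) (t : Fin k → ℝ) :
    duffy (k + 1) ((Fin.last k).insertNth 0 t) =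
      ((Fin.last (k + 1)).insertNth 0 (duffy k t) : Fin (k + 2) → ℝ) := by
  induction k with
  | zero =>
    rw [show Fin.last 0 = 0 from rfl, Fin.insertNth_zero', duffy_cons]
    funext a
    refine Fin.lastCases ?_ (fun a => ?_) a
    · simp [Fin.insertNth_apply_same]
    · obtain rfl : a = 0 := by ext; simp
      rw [Fin.insertNth_last', Fin.snoc_castSucc]
      simp [duffy]
  | succ k ih =>
    rw [← Fin.succ_last, insertNth_succ_eq_cons, duffy_cons, ih, smul_insertNth_zero, duffy_succ,
      ← Fin.succ_last (k + 1), Fin.insertNth_succ_cons]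

lemma duffy_insertNth_zero_insertNth_last {k : ℕ} (i : Fin (k + 1)) (c c' : ℝ) (s : Fin k → ℝ) :
    duffy (k + 2) (i.castSucc.insertNth 0 ((Fin.last k).insertNth c s : Fin (k + 1) → ℝ)) =
      duffy (k + 2) (i.castSucc.insertNth 0 ((Fin.last k).insertNth c' s : Fin (k + 1) → ℝ)) := by
  induction k with
  | zero =>
    obtain rfl : i = 0 := by ext; simp
    simp [Fin.insertNth_zero', duffy_cons]
  | succ k ih =>
    refine Fin.cases ?_ (fun i => ?_) i
    · simp [Fin.insertNth_zero', duffy_cons]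
    · rw [← Fin.succ_last, insertNth_succ_eq_cons, insertNth_succ_eq_cons,
        ← Fin.succ_castSucc, Fin.insertNth_succ_cons, Fin.insertNth_succ_cons, duffy_cons,
        duffy_cons, ih]

/-- The coordinatewise retraction onto the unit cube. -/
def clampCube {k : ℕ} (t : Fin k → ℝ) : Fin k → ℝ := fun j => max 0 (min 1 (t j))

lemma clampCube_mem {k : ℕ} (t : Fin k → ℝ) : clampCube t ∈ Icc (0 : Fin k → ℝ) 1 :=
  ⟨fun _ => le_max_left _ _, fun _ => max_le zero_le_one (min_le_left _ _)⟩

lemma clampCube_eq {k : ℕ} {t : Fin k → ℝ} (ht : t ∈ Icc (0 : Fin k → ℝ) 1) : clampCube t = t := by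
  funext j
  have h0 := ht.1 j
  have h1 := ht.2 j
  simp only [Pi.zero_apply, Pi.one_apply] at h0 h1
  simp [clampCube, h0, h1]

lemma clampCube_insertNth {k : ℕ} (i : Fin (k + 1)) (c : ℝ) (t : Fin k → ℝ) :
    clampCube (i.insertNth c t : Fin (k + 1) → ℝ) =
      i.insertNth (max 0 (min 1 c)) (clampCube t) := by
  funext a
  refine Fin.succAboveCases i ?_ (fun a => ?_) a <;> simp [clampCube]

/-- The Duffy parametrization of the standard simplex, extended to the whole space. -/
noncomputable def duffySimplex (k : ℕ) (t : Fin k → ℝ) : stdSimplex ℝ (Fin (k + 1)) :=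
  ⟨duffy k (clampCube t), duffy_nonneg k (clampCube_mem t), sum_duffy k _⟩

lemma continuous_duffySimplex (k : ℕ) : Continuous (duffySimplex k) := by
  refine Continuous.subtype_mk ((continuous_duffy k).comp (continuous_pi fun j => ?_)) _
  unfold clampCube
  fun_prop

lemma stdSimplex_map_succAbove {k : ℕ} (i : Fin (k + 2)) (x : stdSimplex ℝ (Fin (k + 1))) :
    (stdSimplex.map i.succAbove x : Fin (k + 2) → ℝ) = i.insertNth 0 (x : Fin (k + 1) → ℝ) := by
  classical
  funext b
  rw [stdSimplex.map_coe, FunOnFinite.linearMap_apply_apply]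
  refine Fin.succAboveCases i ?_ (fun b => ?_) b
  · rw [Fin.insertNth_apply_same]
    refine Finset.sum_eq_zero fun a ha => ?_
    simp at ha
  · rw [Fin.insertNth_apply_succAbove]
    simp [Finset.filter_eq']

lemma duffySimplex_insertNth_one (k : ℕ) (i : Fin (k + 1)) (t : Fin k → ℝ) :
    duffySimplex (k + 1) (i.insertNth 1 t) =
      stdSimplex.map i.castSucc.succAbove (duffySimplex k t) := by
  apply stdSimplex.ext
  rw [stdSimplex_map_succAbove]
  change duffy (k + 1) _ = i.castSucc.insertNth 0 (duffy k _)
  rw [clampCube_insertNth, ← duffy_insertNth_one]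
  simp

lemma duffySimplex_insertNth_last_zero (k : ℕ) (t : Fin k → ℝ) :
    duffySimplex (k + 1) ((Fin.last k).insertNth 0 t) =
      stdSimplex.map (Fin.last (k + 1)).succAbove (duffySimplex k t) := by
  apply stdSimplex.ext
  rw [stdSimplex_map_succAbove]
  change duffy (k + 1) _ = (Fin.last (k + 1)).insertNth 0 (duffy k _)
  rw [clampCube_insertNth, ← duffy_insertNth_last_zero]
  simp

lemma duffySimplex_insertNth_zero_insertNth_last {k : ℕ} (i : Fin (k + 1)) (c c' : ℝ)
    (s : Fin k → ℝ) :
    duffySimplex (k + 2) (i.castSucc.insertNth 0 ((Fin.last k).insertNth c s : Fin (k + 1) → ℝ)) =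
      duffySimplex (k + 2)
        (i.castSucc.insertNth 0 ((Fin.last k).insertNth c' s : Fin (k + 1) → ℝ)) := by
  apply stdSimplex.ext
  change duffy (k + 2) _ = duffy (k + 2) _
  simp only [clampCube_insertNth]
  simpa using duffy_insertNth_zero_insertNth_last i (max 0 (min 1 c)) (max 0 (min 1 c'))
    (clampCube s)

/-- The smoothing of a simplex, read on the cube and followed by `u` in every coordinate. -/
noncomputable def smoothing {k l : ℕ} (N : ℕ) (u : ℝ → ℝ)
    (σ : stdSimplex ℝ (Fin (k + 1)) → Fin l → ℝ) (t : Fin k → ℝ) : Fin l → ℝ :=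
  fun j => u (bernsteinOp N (fun s => σ (duffySimplex k s)) t j)

lemma contDiff_comp_bernsteinOp {k l : ℕ} (N : ℕ) {u : ℝ → ℝ} {n : WithTop ℕ∞}
    (hu : ContDiff ℝ n u) (φ : (Fin k → ℝ) → Fin l → ℝ) :
    ContDiff ℝ n (fun t j => u (bernsteinOp N φ t j)) := by
  have h : ContDiff ℝ n (bernsteinOp N φ) := contDiff_bernsteinOp N φ
  exact contDiff_pi.2 fun j => hu.comp (contDiff_pi.1 h j)

lemma contDiff_smoothing {k l : ℕ} (N : ℕ) {u : ℝ → ℝ} {n : WithTop ℕ∞} (hu : ContDiff ℝ n u)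
    (σ : stdSimplex ℝ (Fin (k + 1)) → Fin l → ℝ) : ContDiff ℝ n (smoothing N u σ) :=
  contDiff_comp_bernsteinOp N hu _

/-- The Stokes theorem for the smoothing of a singular simplex. -/
theorem cubeVolume_smoothing {m N : ℕ} (hN : N ≠ 0) {u : ℝ → ℝ} (hu : ContDiff ℝ 2 u)
    (σ : stdSimplex ℝ (Fin (m + 3)) → Fin (m + 2) → ℝ) :
    cubeVolume (smoothing N u σ) = ∑ i : Fin (m + 3), (-1) ^ (i : ℕ) *
      cubeFlux (smoothing N u (fun x => σ (stdSimplex.map i.succAbove x))) := by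
  have h1 : ∀ i : Fin (m + 2), (fun t => smoothing N u σ (i.insertNth 1 t)) =
      smoothing N u (fun x => σ (stdSimplex.map i.castSucc.succAbove x)) := by
    intro i
    funext t j
    simp only [smoothing, bernsteinOp_insertNth_one hN, duffySimplex_insertNth_one]
  have h2 : (fun t => smoothing N u σ ((Fin.last (m + 1)).insertNth 0 t)) =
      smoothing N u (fun x => σ (stdSimplex.map (Fin.last (m + 2)).succAbove x)) := by
    funext t j
    simp only [smoothing, bernsteinOp_insertNth_zero, duffySimplex_insertNth_last_zero]
  have h3 : ∀ i : Fin (m + 1),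
      cubeFlux (fun t => smoothing N u σ (i.castSucc.insertNth 0 t)) = 0 := by
    intro i
    have he : (fun t => smoothing N u σ (i.castSucc.insertNth 0 t)) = fun t j =>
        u (bernsteinOp N (fun s => σ (duffySimplex (m + 2) (i.castSucc.insertNth 0 s))) t j) := by
      funext t j
      simp only [smoothing, bernsteinOp_insertNth_zero]
    rw [he]
    refine cubeFlux_eq_zero_of_const (Fin.last m) ?_ fun t c => ?_
    · exact (contDiff_comp_bernsteinOp N hu _).differentiable (by norm_num)
    · funext j
      rw [bernsteinOp_add_single N (Fin.last m)]
      intro c c' s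
      simp only [duffySimplex_insertNth_zero_insertNth_last i c c' s]
  rw [cubeVolume_eq_sum_cubeFlux (contDiff_smoothing N hu σ)]
  simp only [h1, mul_sub, Finset.sum_sub_distrib]
  rw [Fin.sum_univ_castSucc (n := m + 2),
    Fin.sum_univ_castSucc (n := m + 1) (fun i : Fin (m + 2) => (-1) ^ (i : ℕ) *
      cubeFlux (fun t => smoothing N u σ (i.insertNth 0 t)))]
  simp only [h3, h2, mul_zero, Finset.sum_const_zero, Fin.val_last, Fin.val_castSucc]
  ring

lemma det_jacobian_comp_coord {k : ℕ} {u : ℝ → ℝ} (hu : Differentiable ℝ u)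
    {g : (Fin k → ℝ) → Fin k → ℝ} {t : Fin k → ℝ} (hg : DifferentiableAt ℝ g t) :
    (jacobian (fun t j => u (g t j)) t).det = (∏ j, deriv u (g t j)) * (jacobian g t).det := by
  rw [← Matrix.det_mul_row]
  congr 1
  ext i j
  have h1 : HasFDerivAt (fun t => (fun j => u (g t j)))
      (ContinuousLinearMap.pi fun j => deriv u (g t j) •
        (ContinuousLinearMap.proj (R := ℝ) (φ := fun _ : Fin k => ℝ) j ∘L fderiv ℝ g t)) t := by
    rw [hasFDerivAt_pi]
    intro j
    exact (hu (g t j)).hasDerivAt.comp_hasFDerivAt t ((hasFDerivAt_pi'.1 hg.hasFDerivAt) j)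
  simp only [jacobian, Matrix.of_apply, h1.fderiv]
  rfl

lemma jacobian_comp {k : ℕ} {g f : (Fin k → ℝ) → Fin k → ℝ} {t : Fin k → ℝ}
    (hf : DifferentiableAt ℝ f t) (hg : DifferentiableAt ℝ g (f t)) :
    jacobian (fun t => g (f t)) t = jacobian f t * jacobian g (f t) := by
  ext i j
  have h1 : fderiv ℝ (fun t => g (f t)) t = _ := (hg.hasFDerivAt.comp t hf.hasFDerivAt).fderiv
  simp only [jacobian, Matrix.of_apply, h1, Matrix.mul_apply, ContinuousLinearMap.comp_apply]
  conv_lhs => rw [← Finset.univ_sum_single (fderiv ℝ f t (Pi.single i 1)), map_sum]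
  rw [Finset.sum_apply]
  refine Finset.sum_congr rfl fun a _ => ?_
  have : (Pi.single a (fderiv ℝ f t (Pi.single i 1) a) : Fin k → ℝ) =
      (fderiv ℝ f t (Pi.single i 1) a) • Pi.single a 1 := by
    rw [← Pi.single_smul]; simp
  rw [this, map_smul]; rfl

/-- If a simplex stays at distance at least `2 * r` from the origin, the volume of its smoothing is
eventually zero. -/
lemma eventually_cubeVolume_smoothing_eq_zero {k : ℕ} {r : ℝ} (hr : 0 < r) {u : ℝ → ℝ}
    (hu : ContDiff ℝ 2 u) (hb : ∀ y, r ≤ |y| → deriv u y = 0)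
    {σ : stdSimplex ℝ (Fin (k + 1)) → Fin k → ℝ} (hσ : Continuous σ) (h : ∀ x, 2 * r ≤ ‖σ x‖) :
    ∀ᶠ N in Filter.atTop, cubeVolume (smoothing N u σ) = 0 := by
  filter_upwards [tendstoUniformlyOn_bernsteinOp
    (hσ.comp (continuous_duffySimplex k)).continuousOn hr] with N hN
  refine setIntegral_eq_zero_of_forall_eq_zero fun t ht => ?_
  have h1 : ContDiff ℝ 1 (bernsteinOp N (σ ∘ duffySimplex k)) := contDiff_bernsteinOp _ _
  have h2 : r ≤ ‖bernsteinOp N (σ ∘ duffySimplex k) t‖ := by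
    have h3 := hN t ht
    have h4 := h (duffySimplex k t)
    have h5 := norm_sub_norm_le (σ (duffySimplex k t)) (bernsteinOp N (σ ∘ duffySimplex k) t)
    rw [norm_sub_rev] at h5
    simp only [Function.comp_apply] at h3
    linarith
  obtain ⟨j, hj⟩ : ∃ j, r ≤ |bernsteinOp N (σ ∘ duffySimplex k) t j| := by
    by_contra! hcon
    exact absurd ((pi_norm_lt_iff hr).2 hcon) (not_lt.2 h2)
  change (jacobian (fun t j => u (bernsteinOp N (σ ∘ duffySimplex k) t j)) t).det = 0
  rw [det_jacobian_comp_coord (hu.differentiable (by norm_num))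
    ((h1.differentiable (by norm_num)) t), Finset.prod_eq_zero (Finset.mem_univ j) (hb _ hj),
    zero_mul]

lemma exists_contDiff_deriv_bump {r : ℝ} (hr : 0 < r) : ∃ u : ℝ → ℝ, ContDiff ℝ 2 u ∧
    (∀ y, r ≤ |y| → deriv u y = 0) ∧ (∀ y, 0 ≤ deriv u y) ∧ ∀ y, |y| < r → 0 < deriv u y := by
  set b : ℝ → ℝ := fun y => expNegInvGlue (r ^ 2 - y ^ 2) with hb
  have hbc : ContDiff ℝ 1 b := (expNegInvGlue.contDiff (n := 1)).comp (by fun_prop)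
  have hd : deriv (fun y => ∫ x in (0 : ℝ)..y, b x) = b :=
    funext fun y => Continuous.deriv_integral b hbc.continuous 0 y
  refine ⟨fun y => ∫ x in (0 : ℝ)..y, b x, ?_, ?_, ?_, ?_⟩
  · rw [show (2 : WithTop ℕ∞) = 1 + 1 by norm_num, contDiff_succ_iff_deriv, hd]
    refine ⟨fun y => ?_, by simp, hbc⟩
    exact (intervalIntegral.integral_hasDerivAt_right (hbc.continuous.intervalIntegrable _ _)
      (hbc.continuous.stronglyMeasurableAtFilter _ _) hbc.continuous.continuousAt).differentiableAt
  · intro y hy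
    rw [hd]
    refine expNegInvGlue.zero_of_nonpos ?_
    have := sq_le_sq' (by linarith) hy
    rw [sq_abs] at this
    linarith
  · intro y
    rw [hd]
    exact expNegInvGlue.nonneg _
  · intro y hy
    rw [hd]
    refine expNegInvGlue.pos_of_pos ?_
    have := sq_lt_sq' (by linarith [abs_nonneg y]) hy
    rw [sq_abs] at this
    linarith

/-- The polynomial map with components `P`. -/
noncomputable def polyMap {k : ℕ} (P : Fin k → MvPolynomial (Fin k) ℝ) (t : Fin k → ℝ) :
    Fin k → ℝ := fun j => MvPolynomial.eval t (P j)

lemma contDiff_polyMap {k : ℕ} (P : Fin k → MvPolynomial (Fin k) ℝ) {n : WithTop ℕ∞} :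
    ContDiff ℝ n (polyMap P) := by
  refine contDiff_pi.2 fun j => ?_
  obtain ⟨Φ, h1, h2, -⟩ := exists_contDiff_bernsteinOp_eval (P j)
  have : (fun t => polyMap P t j) = fun t => Φ (0, t) := funext fun t => (h2 t).symm
  rw [this]
  exact (h1 n).comp (contDiff_const.prodMk contDiff_id)

lemma tendsto_cubeVolume_smoothing {k : ℕ} {u : ℝ → ℝ} (hu : ContDiff ℝ 2 u)
    (P : Fin k → MvPolynomial (Fin k) ℝ) {σ : stdSimplex ℝ (Fin (k + 1)) → Fin k → ℝ}
    (hσ : ∀ t ∈ Icc (0 : Fin k → ℝ) 1, σ (duffySimplex k t) = polyMap P t) :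
    Filter.Tendsto (fun N => cubeVolume (smoothing N u σ)) Filter.atTop
      (nhds (cubeVolume fun t j => u (polyMap P t j))) := by
  choose Φ h1 h2 h3 using fun j => exists_contDiff_bernsteinOp_eval (P j)
  set Ψ : ℝ × (Fin k → ℝ) → Fin k → ℝ := fun p j => u (Φ j p) with hΨ
  have hΨc : ContDiff ℝ 2 Ψ := contDiff_pi.2 fun j => hu.comp (h1 j 2)
  set K : ℝ → ℝ := fun ε => cubeVolume fun t => Ψ (ε, t) with hK
  have hj : ∀ ε t, jacobian (fun t => Ψ (ε, t)) t =
      Matrix.of fun i => fderiv ℝ Ψ (ε, t) (0, Pi.single i 1) := by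
    intro ε t
    have h4 : HasFDerivAt (fun t : Fin k → ℝ => (ε, t))
        (ContinuousLinearMap.inr ℝ ℝ (Fin k → ℝ)) t :=
      hasFDerivAt_prodMk_right ε t
    have h5 := ((hΨc.differentiable (by norm_num)) (ε, t)).hasFDerivAt.comp t h4
    have h6 : fderiv ℝ (fun t => Ψ (ε, t)) t = _ := h5.fderiv
    ext i j
    simp [jacobian, h6]
  have hKc : Continuous K := by
    have : Continuous fun p : ℝ × (Fin k → ℝ) => (jacobian (fun t => Ψ (p.1, t)) p.2).det := by
      simp only [hj]
      refine Continuous.matrix_det (continuous_pi fun i => ?_)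
      exact (hΨc.continuous_fderiv (by norm_num)).clm_apply continuous_const
    exact continuous_parametric_integral_of_continuous (f := fun ε t =>
      (jacobian (fun t => Ψ (ε, t)) t).det) this isCompact_Icc
  have hK0 : K 0 = cubeVolume fun t j => u (polyMap P t j) := by
    simp only [hK, hΨ, h2]; rfl
  have hKN : ∀ N : ℕ, N ≠ 0 → K (1 / N) = cubeVolume (smoothing N u σ) := by
    intro N hN
    have : (fun t => Ψ (1 / (N : ℝ), t)) = smoothing N u σ := by
      funext t j
      simp only [hΨ, h3 j N hN, smoothing]
      congr 1
      rw [bernsteinOp_congr N hσ]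
      simp [bernsteinOp, polyMap]
    simp only [hK, this]
  rw [← hK0]
  refine ((hKc.tendsto 0).comp (tendsto_one_div_atTop_nhds_zero_nat (𝕜 := ℝ))).congr' ?_
  filter_upwards [Filter.eventually_ne_atTop 0] with N hN
  exact hKN N hN

lemma cubeVolume_pos {k : ℕ} {u : ℝ → ℝ} (hu : ContDiff ℝ 2 u) (hb : ∀ y, 0 ≤ deriv u y)
    {g : (Fin k → ℝ) → Fin k → ℝ} (hg : ContDiff ℝ 2 g)
    (hdet : ∀ t ∈ Icc (0 : Fin k → ℝ) 1, 0 ≤ (jacobian g t).det) {t₀ : Fin k → ℝ}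
    (ht₀ : ∀ j, t₀ j ∈ Ioo (0 : ℝ) 1) (hpos : 0 < (jacobian g t₀).det)
    (hbpos : ∀ j, 0 < deriv u (g t₀ j)) :
    0 < cubeVolume fun t j => u (g t j) := by
  have hc : ContDiff ℝ 2 (fun t j => u (g t j)) :=
    contDiff_pi.2 fun j => hu.comp (contDiff_pi.1 hg j)
  have hcont : Continuous fun t => (jacobian (fun t j => u (g t j)) t).det :=
    (continuous_jacobian (hc.of_le (by norm_num : (1 : WithTop ℕ∞) ≤ 2))).matrix_det
  have hform : ∀ t, (jacobian (fun t j => u (g t j)) t).det =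
      (∏ j, deriv u (g t j)) * (jacobian g t).det := fun t =>
    det_jacobian_comp_coord (hu.differentiable (by norm_num)) (hg.differentiable (by norm_num) t)
  have hopen : IsOpen ({t | 0 < (jacobian (fun t j => u (g t j)) t).det} ∩
      Set.pi univ fun _ : Fin k => Ioo (0 : ℝ) 1) :=
    (isOpen_lt continuous_const hcont).inter (isOpen_set_pi finite_univ fun _ _ => isOpen_Ioo)
  rw [cubeVolume, setIntegral_pos_iff_support_of_nonneg_ae]
  · refine (hopen.measure_pos volume ⟨t₀, ?_, fun j _ => ht₀ j⟩).trans_le (measure_mono ?_)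
    · rw [Set.mem_ofPred_eq, hform]
      exact mul_pos (Finset.prod_pos fun j _ => hbpos j) hpos
    · rintro t ⟨h1, h2⟩
      exact ⟨(ne_of_gt h1), fun j => (h2 j trivial).1.le, fun j => (h2 j trivial).2.le⟩
  · filter_upwards [ae_restrict_mem measurableSet_Icc] with t ht
    rw [hform]
    exact mul_nonneg (Finset.prod_nonneg fun j _ => hb _) (hdet t ht)
  · exact hcont.continuousOn.integrableOn_compact isCompact_Icc

/-- The tail sums of barycentric coordinates. -/
noncomputable def tailSum {k : ℕ} (x : Fin (k + 1) → ℝ) (j : Fin k) : ℝ :=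
  ∑ i, if j.castSucc < i then x i else 0

lemma tailSum_cons_zero {k : ℕ} (a : ℝ) (x : Fin (k + 1) → ℝ) :
    tailSum (Fin.cons a x : Fin (k + 2) → ℝ) 0 = ∑ i, x i := by
  simp [tailSum, Fin.sum_univ_succ (n := k + 1)]

lemma tailSum_cons_succ {k : ℕ} (a : ℝ) (x : Fin (k + 1) → ℝ) (j : Fin k) :
    tailSum (Fin.cons a x : Fin (k + 2) → ℝ) j.succ = tailSum x j := by
  simp [tailSum, Fin.sum_univ_succ (n := k + 1)]

lemma tailSum_smul {k : ℕ} (a : ℝ) (x : Fin (k + 1) → ℝ) : tailSum (a • x) = a • tailSum x := by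
  funext j
  simp [tailSum, Finset.mul_sum]

lemma tailSum_add {k : ℕ} (x y : Fin (k + 1) → ℝ) : tailSum (x + y) = tailSum x + tailSum y := by
  funext j
  simp only [tailSum, Pi.add_apply, ← Finset.sum_add_distrib]
  exact Finset.sum_congr rfl fun i _ => by split_ifs <;> simp

lemma continuous_tailSum {k : ℕ} : Continuous (tailSum (k := k)) := by
  refine continuous_pi fun j => continuous_finsetSum _ fun i _ => ?_
  split_ifs
  · exact continuous_apply i
  · exact continuous_const

lemma eq_of_tailSum_eq {k : ℕ} {x y : Fin (k + 1) → ℝ} (h : tailSum x = tailSum y)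
    (hs : ∑ i, x i = ∑ i, y i) : x = y := by
  induction k with
  | zero =>
    funext i
    obtain rfl : i = 0 := by ext; simp
    simpa using hs
  | succ k ih =>
    rw [← Fin.cons_self_tail x, ← Fin.cons_self_tail y] at h hs ⊢
    have h0 := congrFun h 0
    simp only [tailSum_cons_zero] at h0
    have h1 := ih (funext fun j => by simpa only [tailSum_cons_succ] using congrFun h j.succ) h0
    simp only [Fin.sum_univ_succ (n := k + 1), Fin.cons_zero, Fin.cons_succ] at hs
    rw [h1] at hs ⊢
    rw [add_right_cancel hs]

lemma exists_tailSum_eq {k : ℕ} (c M : ℝ) (x : Fin k → ℝ) (hc : |c| ≤ M) (hx : ∀ j, |x j| ≤ M) :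
    ∃ z : Fin (k + 1) → ℝ, ∑ i, z i = c ∧ tailSum z = x ∧ ∀ i, |z i| ≤ 2 * M := by
  induction k generalizing c with
  | zero =>
    refine ⟨fun _ => c, by simp, Subsingleton.elim _ _, fun _ => ?_⟩
    linarith [abs_nonneg c]
  | succ k ih =>
    obtain ⟨z, h1, h2, h3⟩ := ih (x 0) (Fin.tail x) (hx 0) (fun j => hx j.succ)
    refine ⟨Fin.cons (c - x 0) z, ?_, ?_, ?_⟩
    · simp [Fin.sum_univ_succ (n := k + 1), h1]
    · funext j
      refine Fin.cases ?_ (fun j => ?_) j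
      · rw [tailSum_cons_zero, h1]
      · rw [tailSum_cons_succ, h2]; rfl
    · intro i
      refine Fin.cases ?_ (fun i => ?_) i
      · rw [Fin.cons_zero]
        linarith [abs_sub c (x 0), hx 0]
      · simpa using h3 i

lemma tailSum_duffy {k : ℕ} (t : Fin k → ℝ) (j : Fin k) :
    tailSum (duffy k t) j = ∏ i, if i ≤ j then t i else 1 := by
  induction k with
  | zero => exact j.elim0
  | succ k ih =>
    rw [duffy_succ, Fin.prod_univ_succ]
    refine Fin.cases ?_ (fun j => ?_) j
    · rw [tailSum_cons_zero]
      simp [← Finset.mul_sum, sum_duffy]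
    · rw [tailSum_cons_succ, tailSum_smul, Pi.smul_apply, ih]
      simp [Fin.tail]

lemma exists_duffy_eq {k : ℕ} {y : Fin (k + 1) → ℝ} (hy : ∀ i, 0 < y i) (hs : ∑ i, y i = 1) :
    ∃ t : Fin k → ℝ, (∀ j, t j ∈ Ioo (0 : ℝ) 1) ∧ duffy k t = y := by
  induction k with
  | zero =>
    refine ⟨fun _ => 0, fun j => j.elim0, funext fun i => ?_⟩
    obtain rfl : i = 0 := by ext; simp
    simpa [duffy] using hs.symm
  | succ k ih =>
    rw [Fin.sum_univ_succ] at hs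
    have hpos : 0 < ∑ i : Fin (k + 1), y i.succ :=
      Finset.sum_pos (fun i _ => hy _) Finset.univ_nonempty
    set a := ∑ i : Fin (k + 1), y i.succ
    obtain ⟨t, h1, h2⟩ := ih (y := a⁻¹ • Fin.tail y)
      (fun i => mul_pos (inv_pos.2 hpos) (hy _))
      (by
        simp only [Pi.smul_apply, smul_eq_mul, ← Finset.mul_sum]
        exact inv_mul_cancel₀ hpos.ne')
    have ha : a < 1 := by linarith [hy 0]
    refine ⟨Fin.cons a t, fun j => Fin.cases ⟨hpos, ha⟩ h1 j, ?_⟩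
    · rw [duffy_cons, h2, smul_smul, mul_inv_cancel₀ hpos.ne', one_smul,
        show 1 - a = y 0 by linarith, Fin.cons_self_tail]

/-- The coordinates of the barycentre. -/
noncomputable def barycentre (k : ℕ) : Fin (k + 1) → ℝ := fun _ => 1 / (k + 1)

lemma sum_barycentre (k : ℕ) : ∑ i, barycentre k i = 1 := by
  have : (k : ℝ) + 1 ≠ 0 := by positivity
  simp [barycentre, this]

/-- An affine embedding of the simplex taking the barycentre to the origin. -/
noncomputable def centredSimplex (k : ℕ) (x : stdSimplex ℝ (Fin (k + 1))) : Fin k → ℝ :=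
  tailSum (x : Fin (k + 1) → ℝ) - tailSum (barycentre k)

lemma continuous_centredSimplex (k : ℕ) : Continuous (centredSimplex k) :=
  (continuous_tailSum.comp continuous_subtype_val).sub continuous_const

lemma centredSimplex_map_succAbove_ne_zero {k : ℕ} (i : Fin (k + 2))
    (x : stdSimplex ℝ (Fin (k + 1))) :
    centredSimplex (k + 1) (stdSimplex.map i.succAbove x) ≠ 0 := by
  intro h
  have h1 := eq_of_tailSum_eq (sub_eq_zero.1 h) (by rw [sum_barycentre, stdSimplex.sum_eq_one])
  have h2 := congrFun h1 i
  rw [stdSimplex_map_succAbove, Fin.insertNth_apply_same] at h2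
  have : (0 : ℝ) < barycentre (k + 1) i := by unfold barycentre; positivity
  exact this.ne h2

/-- The polynomials expressing the Duffy parametrization followed by `centredSimplex`. -/
noncomputable def duffyPoly (k : ℕ) (j : Fin k) : MvPolynomial (Fin k) ℝ :=
  (∏ i, if i ≤ j then MvPolynomial.X i else 1) - MvPolynomial.C (tailSum (barycentre k) j)

lemma polyMap_duffyPoly (k : ℕ) (t : Fin k → ℝ) :
    polyMap (duffyPoly k) t = tailSum (duffy k t) - tailSum (barycentre k) := by
  funext j
  simp only [polyMap, duffyPoly, map_sub, MvPolynomial.eval_C, map_prod, Pi.sub_apply,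
    tailSum_duffy]
  congr 1
  refine Finset.prod_congr rfl fun i _ => ?_
  split_ifs <;> simp

lemma det_jacobian_duffyPoly (k : ℕ) (t : Fin k → ℝ) :
    (jacobian (polyMap (duffyPoly k)) t).det = ∏ j, ∏ i, if i < j then t i else 1 := by
  have hrow : ∀ i j, jacobian (polyMap (duffyPoly k)) t i j =
      deriv (fun s => (∏ l, if l ≤ j then (Function.update t i s) l else 1)) (t i) := by
    intro i j
    have h1 : HasFDerivAt (polyMap (duffyPoly k)) (fderiv ℝ (polyMap (duffyPoly k)) t)
        (Function.update t i (t i)) := by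
      rw [Function.update_eq_self]
      exact ((contDiff_polyMap (n := 1) _).differentiable (by norm_num) t).hasFDerivAt
    have h2 := (hasFDerivAt_pi'.1 h1 j).comp_hasDerivAt (t i) (hasDerivAt_update t i (t i))
    have h3 : ((fun x => polyMap (duffyPoly k) x j) ∘ Function.update t i) = fun s =>
        (∏ l, if l ≤ j then (Function.update t i s) l else 1) - tailSum (barycentre k) j := by
      funext s
      simp [polyMap_duffyPoly, tailSum_duffy]
    rw [h3] at h2
    have h4 := h2.deriv
    rw [deriv_sub_const] at h4
    rw [h4]; rfl
  rw [Matrix.det_of_isUpperTriangular]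
  · refine Finset.prod_congr rfl fun j _ => ?_
    rw [hrow]
    have : (fun s => ∏ l, if l ≤ j then (Function.update t j s) l else 1) =
        fun s => s * ∏ i, if i < j then t i else 1 := by
      funext s
      rw [Fintype.prod_eq_mul_prod_compl j, Fintype.prod_eq_mul_prod_compl j
        (fun i => if i < j then t i else 1)]
      simp only [le_refl, if_true, Function.update_self, lt_irrefl, if_false, one_mul]
      congr 1
      refine Finset.prod_congr rfl fun i hi => ?_
      have hij : i ≠ j := by simpa using hi
      simp [hij, le_iff_lt_or_eq]
    rw [this]
    simp
  · intro i j hij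
    rw [hrow]
    have : (fun s => ∏ l, if l ≤ j then (Function.update t i s) l else 1) =
        fun s => ∏ l, if l ≤ j then t l else 1 := by
      funext s
      refine Finset.prod_congr rfl fun l _ => ?_
      split_ifs with hl
      · rw [Function.update_of_ne]
        exact (lt_of_le_of_lt hl hij).ne
      · rfl
    rw [this, deriv_const]

/-- The volume of the smoothing of the image of the centred simplex under a polynomial map with
nonnegative Jacobian determinant is eventually positive. -/
theorem eventually_cubeVolume_smoothing_pos {k : ℕ} {r : ℝ} (hr : 0 < r) {u : ℝ → ℝ}
    (hu : ContDiff ℝ 2 u) (hb : ∀ y, 0 ≤ deriv u y) (hbr : ∀ y, |y| < r → 0 < deriv u y)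
    (F : Fin k → MvPolynomial (Fin k) ℝ) (hF0 : polyMap F 0 = 0)
    (hF : ∀ x, 0 ≤ (jacobian (polyMap F) x).det)
    (hF' : ∀ δ > 0, ∃ x, ‖x‖ < δ ∧ 0 < (jacobian (polyMap F) x).det) :
    ∀ᶠ N in Filter.atTop,
      0 < cubeVolume (smoothing N u fun x => polyMap F (centredSimplex k x)) := by
  set P : Fin k → MvPolynomial (Fin k) ℝ := fun j => MvPolynomial.bind₁ (duffyPoly k) (F j)
  have hP : ∀ t, polyMap P t = polyMap F (polyMap (duffyPoly k) t) := by
    intro t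
    funext j
    change (MvPolynomial.aeval t) (MvPolynomial.bind₁ (duffyPoly k) (F j)) = _
    rw [MvPolynomial.aeval_bind₁]
    rfl
  have hlim := tendsto_cubeVolume_smoothing hu P
    (σ := fun x => polyMap F (centredSimplex k x)) (fun t ht => by
      rw [hP, polyMap_duffyPoly]
      change polyMap F (tailSum (duffy k (clampCube t)) - _) = _
      rw [clampCube_eq ht])
  refine hlim.eventually (lt_mem_nhds ?_)
  have hdiff : ∀ Q : Fin k → MvPolynomial (Fin k) ℝ, Differentiable ℝ (polyMap Q) := fun Q =>
    (contDiff_polyMap (n := 1) Q).differentiable (by norm_num)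
  have hdet : ∀ t, (jacobian (polyMap P) t).det =
      (∏ j, ∏ i, if i < j then t i else 1) *
        (jacobian (polyMap F) (polyMap (duffyPoly k) t)).det := by
    intro t
    rw [show polyMap P = fun t => polyMap F (polyMap (duffyPoly k) t) from funext hP,
      jacobian_comp (hdiff _ _) (hdiff _ _), Matrix.det_mul, det_jacobian_duffyPoly]
  have hcont : Continuous (polyMap F) := (hdiff F).continuous
  obtain ⟨δ, hδ, hδF⟩ := Metric.continuousAt_iff.1 (hcont.continuousAt (x := 0)) r hr
  obtain ⟨x, hx, hxF⟩ := hF' (min δ (1 / (4 * (k + 1)))) (by positivity)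
  obtain ⟨z, hz0, hzx, hz⟩ := exists_tailSum_eq 0 (1 / (4 * ((k : ℝ) + 1))) x
    (by rw [abs_zero]; positivity)
    (fun j => ((norm_le_pi_norm x j).trans (hx.le.trans (min_le_right _ _))))
  obtain ⟨t, ht, hty⟩ := exists_duffy_eq (y := barycentre k + z)
    (by
      intro i
      have h1 := (abs_le.1 (hz i)).1
      have h2 : 2 * (1 / (4 * ((k : ℝ) + 1))) < 1 / (k + 1) := by
        rw [show 2 * (1 / (4 * ((k : ℝ) + 1))) = 1 / (k + 1) / 2 by
          field_simp; norm_num]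
        exact half_lt_self (by positivity)
      simp only [Pi.add_apply, barycentre]
      linarith)
    (by simp [Finset.sum_add_distrib, sum_barycentre, hz0])
  have htx : polyMap (duffyPoly k) t = x := by
    rw [polyMap_duffyPoly, hty, tailSum_add, hzx, add_sub_cancel_left]
  refine cubeVolume_pos hu hb (contDiff_polyMap P) (fun s hs => ?_) ht ?_ fun j => ?_
  · rw [hdet]
    refine mul_nonneg (Finset.prod_nonneg fun j _ => Finset.prod_nonneg fun i _ => ?_) (hF _)
    split_ifs
    · exact hs.1 i
    · exact zero_le_one
  · rw [hdet, htx]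
    refine mul_pos (Finset.prod_pos fun j _ => Finset.prod_pos fun i _ => ?_) hxF
    split_ifs
    · exact (ht i).1
    · exact zero_lt_one
  · refine hbr _ ?_
    rw [hP, htx]
    have h1 : dist x 0 < δ := by
      rw [dist_zero_right]
      exact hx.trans_le (min_le_left _ _)
    have h2 := hδF h1
    rw [hF0, dist_zero_right] at h2
    exact (norm_le_pi_norm (polyMap F x) j).trans_lt h2

end OrbitMapHomology

namespace OrbitMapHomology

open MeasureTheory Set Simplicial Opposite Filter Topology

/-- Singular simplices, as elements of the singular simplicial set. -/
abbrev SingularSimplex (X : TopCat.{0}) (k : ℕ) : Type := (TopCat.toSSet.obj X) _⦋k⦌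

/-- A singular simplex as a continuous map. -/
noncomputable def toMap {X : TopCat.{0}} {k : ℕ} (σ : SingularSimplex X k) :
    C(stdSimplex ℝ (Fin (k + 1)), X) := X.toSSetObjEquiv (op ⦋k⦌) σ

/-- The singular simplex of a continuous map. -/
noncomputable def ofMap {X : TopCat.{0}} {k : ℕ} (f : C(stdSimplex ℝ (Fin (k + 1)), X)) :
    SingularSimplex X k := (X.toSSetObjEquiv (op ⦋k⦌)).symm f

lemma toMap_injective {X : TopCat.{0}} {k : ℕ} : Function.Injective (toMap (X := X) (k := k)) :=
  Equiv.injective _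

lemma toMap_map {X Y : TopCat.{0}} {k : ℕ} (f : X ⟶ Y) (σ : SingularSimplex X k)
    (x : stdSimplex ℝ (Fin (k + 1))) :
    toMap ((TopCat.toSSet.map f).app (op ⦋k⦌) σ : SingularSimplex Y k) x = f (toMap σ x) := rfl

/-- The chain given by a single singular simplex. -/
noncomputable def chainOf {X : TopCat.{0}} {k : ℕ} (σ : SingularSimplex X k) :
    (singularChainComplexFunctor.obj X).X k :=
  (ModuleCat.freeMk σ : (ModuleCat.free ℝ).obj (SingularSimplex X k))

/-- The linear functional on singular chains with prescribed values on singular simplices. -/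
noncomputable def chainFunctional {X : TopCat.{0}} {k : ℕ} (f : SingularSimplex X k → ℝ) :
    (singularChainComplexFunctor.obj X).X k →ₗ[ℝ] ℝ := Finsupp.linearCombination ℝ f

lemma chainFunctional_chainOf {X : TopCat.{0}} {k : ℕ} (f : SingularSimplex X k → ℝ)
    (σ : SingularSimplex X k) : chainFunctional f (chainOf σ) = f σ :=
  (Finsupp.linearCombination_single ℝ _ _).trans (by simp)

lemma chain_ext {X : TopCat.{0}} {k : ℕ} {M : Type} [AddCommGroup M] [Module ℝ M]
    {f g : (singularChainComplexFunctor.obj X).X k →ₗ[ℝ] M}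
    (h : ∀ σ, f (chainOf σ) = g (chainOf σ)) : f = g :=
  Finsupp.lhom_ext' fun σ => LinearMap.ext_ring (h σ)

lemma alternatingFaceMapComplex_d_apply (S : SimplicialObject (ModuleCat.{0} ℝ)) (k : ℕ)
    (x : S _⦋k + 1⦌) :
    ((AlgebraicTopology.AlternatingFaceMapComplex.obj S).d (k + 1) k).hom x =
      ∑ i : Fin (k + 2), (-1 : ℝ) ^ (i : ℕ) • (S.δ i).hom x := by
  have h : ((AlgebraicTopology.AlternatingFaceMapComplex.obj S).d (k + 1) k).hom x =
      (∑ i : Fin (k + 2), (-1 : ℤ) ^ (i : ℕ) • S.δ i).hom x :=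
    congrArg (fun f => f.hom x) (AlgebraicTopology.AlternatingFaceMapComplex.obj_d_eq S k)
  rw [h, ModuleCat.hom_sum, LinearMap.sum_apply]
  refine Finset.sum_congr rfl fun i _ => ?_
  rw [ModuleCat.hom_zsmul, LinearMap.smul_apply, ← Int.cast_smul_eq_zsmul ℝ]
  push_cast
  rfl

lemma d_chainOf {X : TopCat.{0}} {k : ℕ} (σ : SingularSimplex X (k + 1)) :
    (singularChainComplexFunctor.obj X).d (k + 1) k (chainOf σ) =
      ∑ i : Fin (k + 2), (-1 : ℝ) ^ (i : ℕ) • chainOf ((TopCat.toSSet.obj X).δ i σ) := by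
  refine (alternatingFaceMapComplex_d_apply (((SimplicialObject.whiskering _ _).obj
    (ModuleCat.free ℝ)).obj (TopCat.toSSet.obj X)) k (ModuleCat.freeMk σ)).trans ?_
  refine Finset.sum_congr rfl fun i _ => congrArg _ ?_
  exact ModuleCat.free_map_apply _ _

lemma map_chainOf {X Y : TopCat.{0}} {k : ℕ} (f : X ⟶ Y) (σ : SingularSimplex X k) :
    (singularChainComplexFunctor.map f).f k (chainOf σ) =
      chainOf ((TopCat.toSSet.map f).app (op ⦋k⦌) σ) :=
  ModuleCat.free_map_apply _ _

lemma map_injective {X Y : TopCat.{0}} {f : X ⟶ Y} (hf : Function.Injective f) (k : ℕ) :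
    Function.Injective ((singularChainComplexFunctor.map f).f k) := by
  refine Finsupp.mapDomain_injective (f := (TopCat.toSSet.map f).app (op ⦋k⦌)) fun σ τ h => ?_
  refine toMap_injective (ContinuousMap.ext fun x => hf ?_)
  rw [← toMap_map, ← toMap_map, h]

lemma exists_eq_sum_single {ι : Type*} (w : ι →₀ ℝ) :
    ∃ (s : Finset ι) (c : ι → ℝ), w = ∑ i ∈ s, c i • Finsupp.single i 1 :=
  ⟨w.support, w, by simp [← Finsupp.sum.eq_1]⟩

lemma exists_chain_eq_sum {X : TopCat.{0}} {k : ℕ} (w : (singularChainComplexFunctor.obj X).X k) :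
    ∃ (s : Finset (SingularSimplex X k)) (c : SingularSimplex X k → ℝ),
      w = ∑ σ ∈ s, c σ • chainOf σ :=
  exists_eq_sum_single (ι := SingularSimplex X k) w

/-- If a chain map kills homology, then it sends every cycle to a boundary. -/
lemma exists_boundary_of_homologyMap_eq_zero {C D : ChainComplex (ModuleCat.{0} ℝ) ℕ} {k : ℕ}
    {φ : C ⟶ D} (hφ : HomologicalComplex.homologyMap φ (k + 1) = 0)
    (z : C.X (k + 1)) (hz : C.d (k + 1) k z = 0) :
    ∃ w : D.X (k + 2), D.d (k + 2) (k + 1) w = φ.f (k + 1) z := by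
  let x : ModuleCat.of ℝ ℝ ⟶ C.X (k + 1) :=
    ModuleCat.ofHom (LinearMap.toSpanSingleton ℝ (C.X (k + 1)) z)
  have hx : x ≫ C.d (k + 1) k = 0 := by
    ext
    simpa [x] using hz
  have hx' : (x ≫ φ.f (k + 1)) ≫ D.d (k + 1) k = 0 := by
    rw [Category.assoc, HomologicalComplex.Hom.comm, reassoc_of% hx, Limits.zero_comp]
  obtain ⟨A, π, hπ, y, hy⟩ :=
    (HomologicalComplex.liftCycles_comp_homologyπ_eq_zero_iff_up_to_refinements
      D (k + 2) (k + 1) k (by simp) (by simp) _ hx').1 (by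
      rw [← HomologicalComplex.liftCycles_comp_cyclesMap x k (by simp) hx φ, Category.assoc,
        ← HomologicalComplex.homologyπ_naturality, hφ]
      simp)
  obtain ⟨a, ha⟩ := (ModuleCat.epi_iff_surjective π).1 hπ (1 : ℝ)
  refine ⟨y a, ?_⟩
  have h := congrArg (fun g => g a) hy
  simp only [ModuleCat.comp_apply] at h
  rw [ha] at h
  simpa [x] using h.symm

/-- Punctured Euclidean space. -/
abbrev Punctured (k : ℕ) : TopCat.{0} := TopCat.of {x : Fin k → ℝ // x ≠ 0}

/-- The inclusion of punctured Euclidean space into Euclidean space. -/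
abbrev puncturedIncl (k : ℕ) : Punctured k ⟶ TopCat.of (Fin k → ℝ) :=
  TopCat.ofHom ⟨Subtype.val, continuous_subtype_val⟩

/-- A singular simplex of punctured space as a map to Euclidean space. -/
noncomputable def coordMap {k l : ℕ} (σ : SingularSimplex (Punctured l) k)
    (x : stdSimplex ℝ (Fin (k + 1))) : Fin l → ℝ := puncturedIncl l (toMap σ x)

lemma continuous_coordMap {k l : ℕ} (σ : SingularSimplex (Punctured l) k) :
    Continuous (coordMap σ) :=
  (puncturedIncl l).hom.continuous.comp (toMap σ).continuous

lemma coordMap_ne_zero {k l : ℕ} (σ : SingularSimplex (Punctured l) k)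
    (x : stdSimplex ℝ (Fin (k + 1))) : coordMap σ x ≠ 0 := (toMap σ x).2

lemma coordMap_δ {k l : ℕ} (σ : SingularSimplex (Punctured l) (k + 1)) (i : Fin (k + 2)) :
    coordMap ((TopCat.toSSet.obj (Punctured l)).δ i σ) =
      fun x => coordMap σ (stdSimplex.map i.succAbove x) := rfl

lemma eventually_le_norm_coordMap {k l : ℕ} (σ : SingularSimplex (Punctured l) k) :
    ∀ᶠ r in 𝓝[>] (0 : ℝ), ∀ x, 2 * r ≤ ‖coordMap σ x‖ := by
  obtain ⟨x₀, -, h₀⟩ := isCompact_univ.exists_isMinOn (univ_nonempty)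
    (continuous_coordMap σ).norm.continuousOn
  have hpos : 0 < ‖coordMap σ x₀‖ := norm_pos_iff.2 (coordMap_ne_zero σ x₀)
  filter_upwards [Ioo_mem_nhdsGT (half_pos hpos)] with r hr x
  have := h₀ (mem_univ x)
  simp only [mem_ofPred_eq] at this
  linarith [hr.2]

/-- The boundary of the centred simplex, as a chain in punctured space. -/
noncomputable def boundaryChain (m : ℕ) :
    (singularChainComplexFunctor.obj (Punctured (m + 2))).X (m + 1) :=
  ∑ i : Fin (m + 3), (-1 : ℝ) ^ (i : ℕ) • chainOf (X := Punctured (m + 2))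
    (ofMap ⟨fun x => ⟨centredSimplex (m + 2) (stdSimplex.map i.succAbove x),
      centredSimplex_map_succAbove_ne_zero i x⟩,
      ((continuous_centredSimplex _).comp (stdSimplex.continuous_map _)).subtype_mk _⟩)

lemma d_boundaryChain (m : ℕ) :
    (singularChainComplexFunctor.obj (Punctured (m + 2))).d (m + 1) m (boundaryChain m) = 0 := by
  apply map_injective (f := puncturedIncl (m + 2)) Subtype.val_injective m
  have h : (singularChainComplexFunctor.map (puncturedIncl (m + 2))).f (m + 1) (boundaryChain m) =
      (singularChainComplexFunctor.obj (TopCat.of (Fin (m + 2) → ℝ))).d (m + 2) (m + 1)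
        (chainOf (ofMap ⟨centredSimplex (m + 2), continuous_centredSimplex _⟩)) := by
    rw [d_chainOf, boundaryChain, map_sum]
    refine Finset.sum_congr rfl fun i _ => ?_
    rw [map_smul, map_chainOf]
    rfl
  rw [← ModuleCat.comp_apply, ← HomologicalComplex.Hom.comm, ModuleCat.comp_apply, h,
    ← ModuleCat.comp_apply, HomologicalComplex.d_comp_d, map_zero]
  rfl

/-- The integral of the volume form over the smoothing of a chain. -/
noncomputable def smoothedVolume (N : ℕ) (u : ℝ → ℝ) (k : ℕ) :
    (singularChainComplexFunctor.obj (Punctured k)).X k →ₗ[ℝ] ℝ :=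
  chainFunctional fun σ => cubeVolume (smoothing N u (coordMap σ))

/-- The flux through the smoothing of a chain. -/
noncomputable def smoothedFlux (N : ℕ) (u : ℝ → ℝ) (k : ℕ) :
    (singularChainComplexFunctor.obj (Punctured (k + 1))).X k →ₗ[ℝ] ℝ :=
  chainFunctional fun σ => cubeFlux (smoothing N u (coordMap σ))

lemma smoothedFlux_d {m N : ℕ} (hN : N ≠ 0) {u : ℝ → ℝ} (hu : ContDiff ℝ 2 u) :
    smoothedFlux N u (m + 1) ∘ₗ
      ((singularChainComplexFunctor.obj (Punctured (m + 2))).d (m + 2) (m + 1)).hom =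
    smoothedVolume N u (m + 2) := by
  refine chain_ext fun σ => ?_
  rw [LinearMap.comp_apply]
  refine (congrArg _ (d_chainOf σ)).trans ?_
  rw [map_sum, smoothedVolume, smoothedFlux, chainFunctional_chainOf, cubeVolume_smoothing hN hu]
  refine Finset.sum_congr rfl fun i _ => ?_
  rw [map_smul, chainFunctional_chainOf, coordMap_δ, smul_eq_mul]

lemma smoothedVolume_eq_zero {k N : ℕ} {u : ℝ → ℝ} {s : Finset (SingularSimplex (Punctured k) k)}
    (c : SingularSimplex (Punctured k) k → ℝ)
    (h : ∀ σ ∈ s, cubeVolume (smoothing N u (coordMap σ)) = 0) :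
    smoothedVolume N u k (∑ σ ∈ s, c σ • chainOf σ) = 0 := by
  rw [map_sum]
  refine Finset.sum_eq_zero fun σ hσ => ?_
  rw [map_smul, smoothedVolume, chainFunctional_chainOf, h σ hσ, smul_zero]

lemma smoothedFlux_map_boundaryChain {m N : ℕ} (hN : N ≠ 0) {u : ℝ → ℝ} (hu : ContDiff ℝ 2 u)
    {g : (Fin (m + 2) → ℝ) → Fin (m + 2) → ℝ}
    (f : Punctured (m + 2) ⟶ Punctured (m + 2)) (hf : ∀ y, (f y).1 = g y.1) :
    smoothedFlux N u (m + 1) ((singularChainComplexFunctor.map f).f (m + 1) (boundaryChain m)) =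
      cubeVolume (smoothing N u fun x => g (centredSimplex (m + 2) x)) := by
  rw [boundaryChain, map_sum, map_sum, cubeVolume_smoothing hN hu]
  refine Finset.sum_congr rfl fun i _ => ?_
  rw [map_smul, map_smul, map_chainOf, smoothedFlux, chainFunctional_chainOf, smul_eq_mul]
  congr 3
  ext1 x
  exact hf _

/-- A polynomial map of Euclidean space with nonnegative Jacobian, which is positive at points
arbitrarily close to the origin, is nontrivial on the top homology of punctured space. -/
theorem homology_map_polyMap_ne_zero {m : ℕ} (F : Fin (m + 2) → MvPolynomial (Fin (m + 2)) ℝ)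
    (f : Punctured (m + 2) ⟶ Punctured (m + 2)) (hf : ∀ y, (f y).1 = polyMap F y.1)
    (hF0 : polyMap F 0 = 0) (hF : ∀ x, 0 ≤ (jacobian (polyMap F) x).det)
    (hF' : ∀ δ > 0, ∃ x, ‖x‖ < δ ∧ 0 < (jacobian (polyMap F) x).det) :
    (singularHomologyFunctor (m + 1)).map f ≠ 0 := by
  intro h0
  obtain ⟨w, hw⟩ := exists_boundary_of_homologyMap_eq_zero
    (φ := singularChainComplexFunctor.map f) h0 (boundaryChain m) (d_boundaryChain m)
  obtain ⟨s, c, rfl⟩ := exists_chain_eq_sum w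
  obtain ⟨r, hr, hs⟩ := (eventually_mem_nhdsWithin.and
    ((eventually_all_finset s).2 fun σ _ => eventually_le_norm_coordMap σ)).exists
  obtain ⟨u, hu, hu1, hu2, hu3⟩ := exists_contDiff_deriv_bump (r := r) hr
  have h1 := eventually_cubeVolume_smoothing_pos hr hu hu2 hu3 F hF0 hF hF'
  have h2 := (eventually_all_finset s).2 fun σ hσ =>
    eventually_cubeVolume_smoothing_eq_zero hr hu hu1 (continuous_coordMap σ) (hs σ hσ)
  obtain ⟨N, hN, h1, h2⟩ := ((eventually_ne_atTop 0).and (h1.and h2)).exists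
  have h3 := congrArg (smoothedFlux N u (m + 1)) hw
  rw [smoothedFlux_map_boundaryChain hN hu f hf] at h3
  refine h1.ne' (h3.symm.trans (Eq.trans ?_ (smoothedVolume_eq_zero c h2)))
  exact LinearMap.congr_fun (smoothedFlux_d hN hu) _

end OrbitMapHomology

namespace OrbitMapHomology

open MeasureTheory Set Filter Topology ComplexConjugate Matrix

/-- The block sum of the `1 × 1` identity matrix and `A`. -/
def oneSum {n : ℕ} (A : Matrix (Fin n) (Fin n) ℂ) : Matrix (Fin (n + 1)) (Fin (n + 1)) ℂ :=
  Matrix.of (Fin.cons (Fin.cons 1 0) fun i => Fin.cons 0 (A i))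

@[simp] lemma oneSum_zero_zero {n : ℕ} (A : Matrix (Fin n) (Fin n) ℂ) : oneSum A 0 0 = 1 := rfl

@[simp] lemma oneSum_zero_succ {n : ℕ} (A : Matrix (Fin n) (Fin n) ℂ) (j : Fin n) :
    oneSum A 0 j.succ = 0 := rfl

@[simp] lemma oneSum_succ_zero {n : ℕ} (A : Matrix (Fin n) (Fin n) ℂ) (i : Fin n) :
    oneSum A i.succ 0 = 0 := rfl

@[simp] lemma oneSum_succ_succ {n : ℕ} (A : Matrix (Fin n) (Fin n) ℂ) (i j : Fin n) :
    oneSum A i.succ j.succ = A i j := rfl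

lemma oneSum_one {n : ℕ} : oneSum (1 : Matrix (Fin n) (Fin n) ℂ) = 1 := by
  ext i j
  refine Fin.cases ?_ (fun i => ?_) i <;> refine Fin.cases ?_ (fun j => ?_) j <;>
    simp [Matrix.one_apply, Fin.succ_ne_zero, (Fin.succ_ne_zero _).symm]

lemma oneSum_mul {n : ℕ} (A B : Matrix (Fin n) (Fin n) ℂ) :
    oneSum (A * B) = oneSum A * oneSum B := by
  ext i j
  refine Fin.cases ?_ (fun i => ?_) i <;> refine Fin.cases ?_ (fun j => ?_) j <;>
    simp [Matrix.mul_apply, Fin.sum_univ_succ]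

lemma oneSum_diagonal {n : ℕ} (v : Fin n → ℂ) :
    oneSum (diagonal v) = diagonal (Fin.cons 1 v : Fin (n + 1) → ℂ) := by
  ext i j
  refine Fin.cases ?_ (fun i => ?_) i <;> refine Fin.cases ?_ (fun j => ?_) j <;>
    simp [Matrix.diagonal_apply, (Fin.succ_ne_zero _).symm]

lemma oneSum_conjTranspose {n : ℕ} (A : Matrix (Fin n) (Fin n) ℂ) :
    oneSum Aᴴ = (oneSum A)ᴴ := by
  ext i j
  refine Fin.cases ?_ (fun i => ?_) i <;> refine Fin.cases ?_ (fun j => ?_) j <;> simp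

lemma oneSum_mem {n : ℕ} {A : Matrix (Fin n) (Fin n) ℂ} (hA : A ∈ unitaryGroup (Fin n) ℂ) :
    oneSum A ∈ unitaryGroup (Fin (n + 1)) ℂ := by
  rw [mem_unitaryGroup_iff, star_eq_conjTranspose] at hA ⊢
  rw [← oneSum_conjTranspose, ← oneSum_mul, hA, oneSum_one]

lemma continuous_oneSum {n : ℕ} : Continuous (oneSum (n := n)) := by
  refine continuous_matrix fun i j => ?_
  refine Fin.cases ?_ (fun i => ?_) i <;> refine Fin.cases ?_ (fun j => ?_) j <;>
    simp only [oneSum_zero_zero, oneSum_zero_succ, oneSum_succ_zero, oneSum_succ_succ] <;> fun_prop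

lemma one_ne_succ_succ {k : ℕ} (j : Fin k) : (1 : Fin (k + 2)) ≠ j.succ.succ := by
  rw [← Fin.succ_zero_eq_one, Ne, Fin.succ_inj]
  exact (Fin.succ_ne_zero j).symm

/-- A matrix in `SU(2)`, for `‖w‖ ≤ 1`, embedded in the first two coordinates. -/
noncomputable def rotation (k : ℕ) (w : ℂ) : Matrix (Fin (k + 2)) (Fin (k + 2)) ℂ :=
  Matrix.of (Fin.cons (Fin.cons w (Fin.cons (-(√(1 - ‖w‖ ^ 2) : ℝ)) 0))
    (Fin.cons (Fin.cons (√(1 - ‖w‖ ^ 2) : ℝ) (Fin.cons (conj w) 0))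
      fun i => Fin.cons 0 (Fin.cons 0 fun j => (1 : Matrix (Fin k) (Fin k) ℂ) i j)))

lemma rotation_mem (k : ℕ) {w : ℂ} (hw : ‖w‖ ≤ 1) :
    rotation k w ∈ unitaryGroup (Fin (k + 2)) ℂ := by
  have h : (√(1 - ‖w‖ ^ 2) : ℂ) * (√(1 - ‖w‖ ^ 2) : ℝ) = 1 - w * conj w := by
    rw [← Complex.ofReal_mul, Real.mul_self_sqrt (by nlinarith [norm_nonneg w]),
      Complex.mul_conj, Complex.normSq_eq_norm_sq]
    push_cast
    rfl
  rw [mem_unitaryGroup_iff, star_eq_conjTranspose]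
  ext i j
  refine Fin.cases ?_ (Fin.cases ?_ fun i => ?_) i <;>
    refine Fin.cases ?_ (Fin.cases ?_ fun j => ?_) j
  all_goals
    simp [rotation, Matrix.mul_apply, Fin.sum_univ_succ, Matrix.one_apply, Fin.succ_ne_zero, h,
      (Fin.succ_ne_zero _).symm, mul_comm, one_ne_succ_succ, (one_ne_succ_succ _).symm]

lemma continuous_rotation (k : ℕ) : Continuous (rotation k) := by
  refine continuous_matrix fun i j => ?_
  refine Fin.cases ?_ (Fin.cases ?_ fun i => ?_) i <;>
    refine Fin.cases ?_ (Fin.cases ?_ fun j => ?_) j <;>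
    simp [rotation] <;> fun_prop

/-- The diagonal matrix with entries `z ^ k, conj z, …, conj z`. -/
def twist (k : ℕ) (z : ℂ) : Matrix (Fin (k + 1)) (Fin (k + 1)) ℂ :=
  diagonal (Fin.cons (z ^ k) fun _ => conj z)

lemma continuous_twist (k : ℕ) : Continuous (twist k) := by
  refine Continuous.matrix_diagonal (continuous_pi fun i => ?_)
  refine Fin.cases ?_ (fun i => ?_) i <;> simp <;> fun_prop

lemma oneSum_mul_twist {k : ℕ} (A : Matrix (Fin k) (Fin k) ℂ) (z : ℂ) :
    oneSum A * twist k z = twist k z * oneSum A := by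
  ext i j
  rw [twist, mul_diagonal, diagonal_mul]
  refine Fin.cases ?_ (fun i => ?_) i <;> refine Fin.cases ?_ (fun j => ?_) j <;>
    simp [mul_comm]

/-- An extension of the loop `twist k` in the unitary group to the disc. -/
noncomputable def twistDisc : ∀ k : ℕ, ℂ → Matrix (Fin (k + 1)) (Fin (k + 1)) ℂ
  | 0, _ => 1
  | k + 1, z => rotation k (z ^ (k + 1)) * oneSum (twistDisc k z)

lemma twistDisc_mem (k : ℕ) {z : ℂ} (hz : ‖z‖ ≤ 1) :
    twistDisc k z ∈ unitaryGroup (Fin (k + 1)) ℂ := by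
  induction k with
  | zero => exact one_mem _
  | succ k ih =>
    refine mul_mem (rotation_mem k ?_) (oneSum_mem ih)
    rw [norm_pow]
    exact pow_le_one₀ (norm_nonneg z) hz

lemma continuous_twistDisc (k : ℕ) : Continuous (twistDisc k) := by
  induction k with
  | zero => exact continuous_const
  | succ k ih =>
    exact ((continuous_rotation k).comp (continuous_pow _)).mul (continuous_oneSum.comp ih)

lemma twistDisc_eq_twist (k : ℕ) {z : ℂ} (hz : ‖z‖ = 1) : twistDisc k z = twist k z := by
  induction k with
  | zero =>
    ext i j
    rw [Fin.fin_one_eq_zero i, Fin.fin_one_eq_zero j]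
    simp [twistDisc, twist]
  | succ k ih =>
    have hz' : conj z * z = 1 := by simp [Complex.conj_mul', hz]
    have hr : rotation k (z ^ (k + 1)) =
        diagonal (Fin.cons (z ^ (k + 1)) (Fin.cons (conj z ^ (k + 1)) 1)) := by
      ext i j
      refine Fin.cases ?_ (Fin.cases ?_ fun i => ?_) i <;>
        refine Fin.cases ?_ (Fin.cases ?_ fun j => ?_) j <;>
        simp [rotation, hz, diagonal_apply, Matrix.one_apply, (Fin.succ_ne_zero _).symm,
          one_ne_succ_succ, (one_ne_succ_succ _).symm]
    rw [twistDisc, ih, hr, twist, oneSum_diagonal, diagonal_mul_diagonal, twist]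
    congr 1
    ext1 i
    refine Fin.cases ?_ (Fin.cases ?_ fun i => ?_) i
    · simp
    · simp only [Fin.cons_succ, Fin.cons_zero]
      rw [pow_succ', mul_assoc, ← mul_pow, hz', one_pow, mul_one]
    · simp

lemma twistDisc_succ_col (k : ℕ) (z : ℂ) (i : Fin (k + 2)) :
    twistDisc (k + 1) z i 0 = rotation k (z ^ (k + 1)) i 0 := by
  simp [twistDisc, Matrix.mul_apply, Fin.sum_univ_succ]

/-- A continuous choice of unitary matrices whose first column has, up to positive factors, powers
of the coordinates of a given nonzero vector as its entries. -/
noncomputable def suslin : ∀ k : ℕ, (Fin (k + 1) → ℂ) → Matrix (Fin (k + 1)) (Fin (k + 1)) ℂ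
  | 0, a => if a 0 = 0 then 1 else Matrix.of fun _ _ => a 0 / ‖a 0‖
  | k + 1, a => oneSum (suslin k (Fin.tail a)) *
      twistDisc (k + 1) (a 0 / (‖a 0‖ + ‖Fin.tail a‖ : ℝ)) * (oneSum (suslin k (Fin.tail a)))ᴴ

lemma norm_div_norm_add_le (a : ℂ) {r : ℝ} (hr : 0 ≤ r) : ‖a / (‖a‖ + r : ℝ)‖ ≤ 1 := by
  rw [norm_div, Complex.norm_real, Real.norm_of_nonneg (by positivity)]
  exact div_le_one_of_le₀ (by linarith) (by positivity)

lemma suslin_mem (k : ℕ) (a : Fin (k + 1) → ℂ) : suslin k a ∈ unitaryGroup (Fin (k + 1)) ℂ := by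
  induction k with
  | zero =>
    rw [suslin]
    split_ifs with h
    · exact one_mem _
    · rw [mem_unitaryGroup_iff]
      ext i j
      have h' : (‖a 0‖ : ℂ) ≠ 0 := by simpa using h
      rw [Fin.fin_one_eq_zero i, Fin.fin_one_eq_zero j]
      simp [Matrix.mul_apply]
      rw [div_mul_div_comm, Complex.mul_conj']
      field_simp
  | succ k ih =>
    have h := oneSum_mem (ih (Fin.tail a))
    exact mul_mem (mul_mem h (twistDisc_mem _ (norm_div_norm_add_le _ (norm_nonneg _))))
      (Unitary.star_mem h)

lemma continuous_norm_tail {k : ℕ} :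
    Continuous fun a : Fin (k + 1) → ℂ => ‖a 0‖ + ‖Fin.tail a‖ := by
  have : Continuous fun a : Fin (k + 1) → ℂ => Fin.tail a :=
    continuous_pi fun i => continuous_apply i.succ
  fun_prop

lemma norm_tail_pos {k : ℕ} {a : Fin (k + 1) → ℂ} (ha : a ≠ 0) : 0 < ‖a 0‖ + ‖Fin.tail a‖ := by
  by_contra! h
  have h0 := norm_nonneg (a 0)
  have h1 := norm_nonneg (Fin.tail a)
  have h2 : a 0 = 0 := norm_eq_zero.1 (by linarith)
  have h3 : Fin.tail a = 0 := norm_eq_zero.1 (by linarith)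
  exact ha (funext (Fin.cases h2 fun i => congrFun h3 i))

lemma continuousAt_suslin (k : ℕ) {a : Fin (k + 1) → ℂ} (ha : a ≠ 0) :
    ContinuousAt (suslin k) a := by
  induction k with
  | zero =>
    have h0 : a 0 ≠ 0 := fun h => ha (funext fun i => by rw [Fin.fin_one_eq_zero i]; exact h)
    have h : ContinuousAt (fun b : Fin 1 → ℂ => (Matrix.of fun _ _ => b 0 / ‖b 0‖ :
        Matrix (Fin 1) (Fin 1) ℂ)) a := by
      refine continuousAt_pi.2 fun i => continuousAt_pi.2 fun j => ?_
      have hc : Continuous fun b : Fin 1 → ℂ => b 0 := continuous_apply 0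
      exact ContinuousAt.div hc.continuousAt
        (Complex.continuous_ofReal.comp hc.norm).continuousAt (by simpa using h0)
    refine h.congr ?_
    filter_upwards [(continuous_apply (0 : Fin 1)).continuousAt.eventually_ne h0] with b hb
    rw [suslin, if_neg hb]
  | succ k ih =>
    let z : (Fin (k + 2) → ℂ) → ℂ := fun b => b 0 / (‖b 0‖ + ‖Fin.tail b‖ : ℝ)
    have hz : ContinuousAt z a := by
      refine ContinuousAt.div (continuous_apply 0).continuousAt ?_
        (by exact_mod_cast (norm_tail_pos ha).ne')
      exact (Complex.continuous_ofReal.comp continuous_norm_tail).continuousAt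
    have htail : Continuous fun b : Fin (k + 2) → ℂ => Fin.tail b :=
      continuous_pi fun i => continuous_apply i.succ
    by_cases h : Fin.tail a = 0
    · have hza : ‖z a‖ = 1 := by
        have h0 : ‖a 0‖ ≠ 0 := by simpa [h] using (norm_tail_pos ha).ne'
        simp [z, h, h0]
      have key : ∀ b, suslin (k + 1) b = twist (k + 1) (z b) +
          oneSum (suslin k (Fin.tail b)) * (twistDisc (k + 1) (z b) - twist (k + 1) (z b)) *
            (oneSum (suslin k (Fin.tail b)))ᴴ := fun b => by
        have hB := oneSum_mem (suslin_mem k (Fin.tail b))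
        rw [mem_unitaryGroup_iff, star_eq_conjTranspose] at hB
        rw [Matrix.mul_sub, Matrix.sub_mul, oneSum_mul_twist, Matrix.mul_assoc (twist _ _), hB,
          Matrix.mul_one, suslin]
        abel
      rw [ContinuousAt, funext key]
      refine Tendsto.add ((continuous_twist _).continuousAt.comp hz) ?_
      have hlim : Tendsto (fun b => twistDisc (k + 1) (z b) - twist (k + 1) (z b)) (𝓝 a) (𝓝 0) := by
        have := ((continuous_twistDisc (k + 1)).sub (continuous_twist (k + 1))).continuousAt.comp hz
        have h0 : twistDisc (k + 1) (z a) - twist (k + 1) (z a) = 0 := by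
          rw [twistDisc_eq_twist _ hza, sub_self]
        exact h0 ▸ this
      rw [twistDisc_eq_twist _ hza, sub_self, Matrix.mul_zero, Matrix.zero_mul]
      refine tendsto_pi_nhds.2 fun i => tendsto_pi_nhds.2 fun j => ?_
      simp only [Matrix.mul_apply, Matrix.zero_apply, Finset.sum_mul]
      rw [← Finset.sum_const_zero (s := (Finset.univ : Finset (Fin (k + 2))))]
      refine tendsto_finsetSum _ fun p _ => ?_
      rw [← Finset.sum_const_zero (s := (Finset.univ : Finset (Fin (k + 2))))]
      refine tendsto_finsetSum _ fun q _ => ?_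
      have hpq := tendsto_pi_nhds.1 (tendsto_pi_nhds.1 hlim q) p
      refine squeeze_zero_norm (fun b => ?_) (tendsto_norm_zero.comp hpq)
      have hB := entry_norm_bound_of_unitary (oneSum_mem (suslin_mem k (Fin.tail b)))
      rw [conjTranspose_apply, norm_mul, norm_mul, norm_star]
      refine (mul_le_of_le_one_right (by positivity) (hB _ _)).trans ?_
      exact mul_le_of_le_one_left (norm_nonneg _) (hB _ _)
    · have hA : ContinuousAt (fun b => oneSum (suslin k (Fin.tail b))) a :=
        continuous_oneSum.continuousAt.comp
          (ContinuousAt.comp (f := fun b : Fin (k + 2) → ℂ => Fin.tail b) (ih h)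
            htail.continuousAt)
      exact (hA.mul ((continuous_twistDisc (k + 1)).continuousAt.comp hz)).mul hA.star

/-- The exponents of the coordinates in the first column of `suslin`. -/
def suslinExponent : ∀ k : ℕ, Fin (k + 1) → ℕ
  | 0 => fun _ => 1
  | k + 1 => Fin.cons (k + 1) (suslinExponent k)

lemma suslinExponent_ne_zero (k : ℕ) (j : Fin (k + 1)) : suslinExponent k j ≠ 0 := by
  induction k with
  | zero => exact one_ne_zero
  | succ k ih => exact Fin.cases (Nat.succ_ne_zero k) ih j

lemma exists_suslin_col (k : ℕ) {a : Fin (k + 1) → ℂ} (ha : a ≠ 0) (j : Fin (k + 1)) :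
    ∃ c : ℝ, 0 ≤ c ∧ (a j ≠ 0 → 0 < c) ∧ suslin k a j 0 = c * a j ^ suslinExponent k j := by
  induction k with
  | zero =>
    have h0 : a 0 ≠ 0 := fun h => ha (funext fun i => by rw [Fin.fin_one_eq_zero i]; exact h)
    rw [Fin.fin_one_eq_zero j]
    refine ⟨‖a 0‖⁻¹, by positivity, fun h => by positivity, ?_⟩
    simp [suslin, h0, suslinExponent, div_eq_inv_mul]
  | succ k ih =>
    set B := oneSum (suslin k (Fin.tail a)) with hB
    set ρ := ‖a 0‖ + ‖Fin.tail a‖ with hρ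
    have hρ0 : 0 < ρ := norm_tail_pos ha
    set w := (a 0 / (ρ : ℝ)) ^ (k + 1) with hw
    have h1 : ∀ i, suslin (k + 1) a i 0 = ∑ p, B i p * rotation k w p 0 := fun i => by
      rw [suslin, Matrix.mul_apply, Fin.sum_univ_succ]
      simp [Matrix.mul_apply, twistDisc_succ_col, hB, hρ, hw]
    refine Fin.cases ?_ (fun j => ?_) j
    · refine ⟨(ρ ^ (k + 1))⁻¹, by positivity, fun _ => by positivity, ?_⟩
      rw [h1, Fin.sum_univ_succ]
      simp [hB, rotation, hw, suslinExponent, div_eq_inv_mul, mul_pow]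
    · have h2 : suslin (k + 1) a j.succ 0 = (√(1 - ‖w‖ ^ 2) : ℝ) * suslin k (Fin.tail a) j 0 := by
        rw [h1, Fin.sum_univ_succ, Fin.sum_univ_succ]
        simp [hB, rotation, mul_comm]
        exact Or.inl rfl
      by_cases h : Fin.tail a = 0
      · refine ⟨0, le_rfl, fun hj => absurd (congrFun h j) hj, ?_⟩
        have hw1 : ‖w‖ = 1 := by
          have h0 : ‖a 0‖ ≠ 0 := by simpa [hρ, h] using hρ0.ne'
          simp [hw, hρ, h, h0]
        simp [h2, hw1]
      · obtain ⟨c, hc0, hc1, hc2⟩ := ih h j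
        refine ⟨√(1 - ‖w‖ ^ 2) * c, by positivity, fun hj => ?_, ?_⟩
        · refine mul_pos (Real.sqrt_pos.2 ?_) (hc1 hj)
          have : ‖w‖ < 1 := by
            rw [hw, norm_pow, norm_div, Complex.norm_real, Real.norm_of_nonneg hρ0.le]
            refine pow_lt_one₀ (by positivity) ((div_lt_one hρ0).2 ?_) (by simp)
            linarith [norm_pos_iff.2 h]
          nlinarith [norm_nonneg w]
        · rw [h2, hc2]
          push_cast
          simp only [suslinExponent, Fin.cons_succ]
          rw [mul_assoc]
          rfl

lemma det_jacobian {k : ℕ} (h : (Fin k → ℝ) → Fin k → ℝ) (t : Fin k → ℝ) :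
    (jacobian h t).det = LinearMap.det (fderiv ℝ h t : (Fin k → ℝ) →ₗ[ℝ] Fin k → ℝ) := by
  rw [← LinearMap.det_toMatrix', ← Matrix.det_transpose]
  congr 1

/-- An enumeration of the real coordinates on `Fin (k + 1) → ℂ`. -/
noncomputable def realIndex (k : ℕ) : Fin (k + 1) × Fin 2 ≃ Fin (2 * k + 2) :=
  Fintype.equivFinOfCardEq (by simp; ring)

/-- The real coordinates of a complex vector. -/
noncomputable def realCoords (k : ℕ) : (Fin (k + 1) → ℂ) ≃L[ℝ] (Fin (2 * k + 2) → ℝ) :=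
  LinearEquiv.toContinuousLinearEquiv
  { toFun a i := if ((realIndex k).symm i).2 = 0 then (a ((realIndex k).symm i).1).re
      else (a ((realIndex k).symm i).1).im
    invFun x j := ⟨x (realIndex k (j, 0)), x (realIndex k (j, 1))⟩
    map_add' a b := by ext i; by_cases h : ((realIndex k).symm i).2 = 0 <;> simp [h]
    map_smul' c a := by ext i; by_cases h : ((realIndex k).symm i).2 = 0 <;> simp [h]
    left_inv a := by ext j; simp
    right_inv x := by
      ext i
      obtain ⟨⟨j, b⟩, rfl⟩ := (realIndex k).surjective i
      fin_cases b <;> simp }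

lemma realCoords_symm_apply {k : ℕ} (x : Fin (2 * k + 2) → ℝ) (j : Fin (k + 1)) :
    (realCoords k).symm x j = ⟨x (realIndex k (j, 0)), x (realIndex k (j, 1))⟩ := rfl

lemma realCoords_apply {k : ℕ} (a : Fin (k + 1) → ℂ) (i : Fin (2 * k + 2)) :
    realCoords k a i = if ((realIndex k).symm i).2 = 0 then (a ((realIndex k).symm i).1).re
      else (a ((realIndex k).symm i).1).im := rfl

lemma exists_mvPolynomial_pow {σ : Type*} (p q : σ) (d : ℕ) : ∃ P Q : MvPolynomial σ ℝ,
    ∀ x : σ → ℝ, (⟨x p, x q⟩ : ℂ) ^ d = ⟨P.eval x, Q.eval x⟩ := by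
  induction d with
  | zero => exact ⟨1, 0, fun x => by apply Complex.ext <;> simp⟩
  | succ d ih =>
    obtain ⟨P, Q, h⟩ := ih
    refine ⟨P * .X p - Q * .X q, P * .X q + Q * .X p, fun x => ?_⟩
    rw [pow_succ, h]
    apply Complex.ext <;> simp

lemma exists_polyMap_eq {k : ℕ} (d : Fin (k + 1) → ℕ) :
    ∃ F : Fin (2 * k + 2) → MvPolynomial (Fin (2 * k + 2)) ℝ,
      ∀ x, polyMap F x = realCoords k fun j => (realCoords k).symm x j ^ d j := by
  choose P Q h using fun j : Fin (k + 1) =>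
    exists_mvPolynomial_pow (realIndex k (j, 0)) (realIndex k (j, 1)) (d j)
  refine ⟨fun i => if ((realIndex k).symm i).2 = 0 then P ((realIndex k).symm i).1
    else Q ((realIndex k).symm i).1, fun x => ?_⟩
  ext i
  rw [realCoords_apply, realCoords_symm_apply, h, polyMap]
  split_ifs <;> rfl

/-- The coordinatewise power map has Jacobian `∏ |d a ^ (d - 1)|²`. -/
lemma det_jacobian_pow {k : ℕ} (d : Fin (k + 1) → ℕ) (x : Fin (2 * k + 2) → ℝ) :
    (jacobian (fun x => realCoords k fun j => (realCoords k).symm x j ^ d j) x).det =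
      Complex.normSq (∏ j, (d j * (realCoords k).symm x j ^ (d j - 1))) := by
  set a := (realCoords k).symm x with ha
  let L : (Fin (k + 1) → ℂ) →L[ℂ] (Fin (k + 1) → ℂ) := ContinuousLinearMap.pi fun j =>
    (d j * a j ^ (d j - 1)) • ContinuousLinearMap.proj j
  have hL : HasFDerivAt (fun a : Fin (k + 1) → ℂ => fun j => a j ^ d j) L a := by
    refine hasFDerivAt_pi.2 fun j => ?_
    exact (hasDerivAt_pow (d j) (a j)).comp_hasFDerivAt a
      (ContinuousLinearMap.proj (R := ℂ) (φ := fun _ : Fin (k + 1) => ℂ) j).hasFDerivAt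
  have h := (realCoords k).hasFDerivAt.comp x
    ((hL.restrictScalars ℝ).comp x (realCoords k).symm.hasFDerivAt)
  have h' : fderiv ℝ (fun x => realCoords k fun j => (realCoords k).symm x j ^ d j) x = _ :=
    h.fderiv
  have hdet : LinearMap.det (L : (Fin (k + 1) → ℂ) →ₗ[ℂ] Fin (k + 1) → ℂ) =
      ∏ j, (d j * a j ^ (d j - 1)) := by
    rw [← Matrix.det_diagonal, ← LinearMap.det_toLin']
    congr 1
    ext v j
    simp [L, Matrix.mulVec_diagonal]
  rw [det_jacobian, h', ← hdet, ← Algebra.norm_complex_apply,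
    ← LinearMap.det_restrictScalars, ← LinearMap.det_conj _ (realCoords k).toLinearEquiv]
  rfl

lemma singularHomologyFunctor_map_eq {X Y : TopCat.{0}} {f g : X ⟶ Y} (H : TopCat.Homotopy f g)
    (n : ℕ) : (singularHomologyFunctor n).map f = (singularHomologyFunctor n).map g :=
  (H.toSSet.toSimplicialObjectHomotopy.whiskerRight (ModuleCat.free ℝ)).map_homology_eq n

/-- `suslin` as a map from punctured space to the unitary group. -/
noncomputable def suslinMap (k : ℕ) :
    Punctured (2 * k + 2) ⟶ TopCat.of (unitaryGroup (Fin (k + 1)) ℂ) :=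
  TopCat.ofHom ⟨fun x => ⟨suslin k ((realCoords k).symm x.1), suslin_mem k _⟩, by
    refine Continuous.subtype_mk (continuous_iff_continuousAt.2 fun x => ?_) _
    have hx : (realCoords k).symm x.1 ≠ 0 := by simpa using x.2
    exact ContinuousAt.comp (f := fun x : {x : Fin (2 * k + 2) → ℝ // x ≠ 0} =>
      (realCoords k).symm x.1) (continuousAt_suslin k hx) (by fun_prop)⟩

/-- The inclusion of the unit sphere of complex space into punctured real space. -/
noncomputable def sphereIncl (k : ℕ) :
    TopCat.of (Metric.sphere (0 : EuclideanSpace ℂ (Fin (k + 1))) 1) ⟶ Punctured (2 * k + 2) :=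
  TopCat.ofHom ⟨fun v => ⟨realCoords k v.1, by
    have hv : v.1 ≠ 0 := fun h => by simpa [h] using v.2
    rw [Ne, (realCoords k).map_eq_zero_iff]
    exact fun h => hv (PiLp.ext (congrFun h))⟩, by
    refine Continuous.subtype_mk ((realCoords k).continuous.comp ?_) _
    exact (PiLp.continuous_ofLp 2 _).comp continuous_subtype_val⟩

lemma singularHomologyFunctor_map_eq_of_segment {X : TopCat.{0}} {l : ℕ} {f g : X ⟶ Punctured l}
    (h : ∀ x, ∀ t ∈ Icc (0 : ℝ) 1, (1 - t) • (f x).1 + t • (g x).1 ≠ 0) (n : ℕ) :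
    (singularHomologyFunctor n).map f = (singularHomologyFunctor n).map g := by
  have hf : Continuous fun x => (f x).1 := continuous_subtype_val.comp f.hom.continuous
  have hg : Continuous fun x => (g x).1 := continuous_subtype_val.comp g.hom.continuous
  have H : TopCat.Homotopy f g :=
  { toFun p := ⟨(1 - p.1.1) • (f p.2).1 + p.1.1 • (g p.2).1, h p.2 p.1.1 p.1.2⟩
    continuous_toFun := by
      refine Continuous.subtype_mk ?_ _
      have h1 : Continuous fun p : unitInterval × X => (p.1 : ℝ) :=
        continuous_subtype_val.comp continuous_fst
      exact ((continuous_const.sub h1).smul (hf.comp continuous_snd)).add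
        (h1.smul (hg.comp continuous_snd))
    map_zero_left x := Subtype.ext (by simp)
    map_one_left x := Subtype.ext (by simp) }
  exact singularHomologyFunctor_map_eq H n

lemma sphereIncl_orbit_suslinMap {k : ℕ}
    {θ : TopCat.of (unitaryGroup (Fin (k + 1)) ℂ) ⟶
      TopCat.of (Metric.sphere (0 : EuclideanSpace ℂ (Fin (k + 1))) 1)}
    (hθ : ∀ A : unitaryGroup (Fin (k + 1)) ℂ, Subtype.val (θ A) =
      (A : Matrix (Fin (k + 1)) (Fin (k + 1)) ℂ).mulVec (EuclideanSpace.single 0 (1 : ℂ)))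
    (x : Punctured (2 * k + 2)) :
    ((suslinMap k ≫ θ ≫ sphereIncl k) x).1 =
      realCoords k fun j => suslin k ((realCoords k).symm x.1) j 0 := by
  have h1 : ((suslinMap k ≫ θ ≫ sphereIncl k) x).1 =
    realCoords k (Subtype.val (θ (suslinMap k x))).ofLp := rfl
  rw [h1, hθ]
  congr 1
  ext j
  change ((suslin k ((realCoords k).symm x.1)).mulVec (EuclideanSpace.single 0 (1 : ℂ))) j = _
  simp

theorem singularHomologyFunctor_map_orbit_ne_zero {k : ℕ}
    {θ : TopCat.of (unitaryGroup (Fin (k + 1)) ℂ) ⟶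
      TopCat.of (Metric.sphere (0 : EuclideanSpace ℂ (Fin (k + 1))) 1)}
    (hθ : ∀ A : unitaryGroup (Fin (k + 1)) ℂ, Subtype.val (θ A) =
      (A : Matrix (Fin (k + 1)) (Fin (k + 1)) ℂ).mulVec (EuclideanSpace.single 0 (1 : ℂ))) :
    (singularHomologyFunctor (2 * k + 1)).map θ ≠ 0 := by
  intro h0
  obtain ⟨F, hF⟩ := exists_polyMap_eq (suslinExponent k)
  have hdet : ∀ x, (jacobian (polyMap F) x).det = Complex.normSq
      (∏ j, (suslinExponent k j * (realCoords k).symm x j ^ (suslinExponent k j - 1))) := by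
    rw [funext hF]
    exact det_jacobian_pow _
  have hne : ∀ x : Punctured (2 * k + 2), polyMap F x.1 ≠ 0 := fun x hx => by
    rw [hF, (realCoords k).map_eq_zero_iff] at hx
    refine x.2 ((realCoords k).symm.map_eq_zero_iff.1 (funext fun j => ?_))
    exact eq_zero_of_pow_eq_zero (congrFun hx j)
  let f : Punctured (2 * k + 2) ⟶ Punctured (2 * k + 2) := TopCat.ofHom
    ⟨fun x => ⟨polyMap F x.1, hne x⟩,
      ((contDiff_polyMap F (n := 0)).continuous.comp continuous_subtype_val).subtype_mk _⟩
  refine homology_map_polyMap_ne_zero (m := 2 * k) F f (fun _ => rfl) ?_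
    (fun x => by rw [hdet]; exact Complex.normSq_nonneg _) (fun δ hδ => ?_) ?_
  · rw [hF, (realCoords k).map_eq_zero_iff]
    ext j
    simp [suslinExponent_ne_zero]
  · let a : ℝ → Fin (2 * k + 2) → ℝ := fun ε => realCoords k fun _ => (ε : ℂ)
    have ha : Tendsto (fun ε => ‖a ε‖) (𝓝[>] 0) (𝓝 0) := by
      have hc : Continuous fun ε => ‖a ε‖ := by
        have : Continuous fun ε : ℝ => (fun _ => (ε : ℂ) : Fin (k + 1) → ℂ) :=
          continuous_pi fun _ => Complex.continuous_ofReal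
        exact ((realCoords k).continuous.comp this).norm
      have h00 : ‖a 0‖ = 0 := by
        rw [norm_eq_zero, (realCoords k).map_eq_zero_iff]
        ext j
        simp
      have := (hc.tendsto 0).mono_left (nhdsWithin_le_nhds (s := Ioi 0))
      rwa [h00] at this
    obtain ⟨ε, hε, hε'⟩ := (eventually_mem_nhdsWithin.and (ha.eventually_lt_const hδ)).exists
    refine ⟨a ε, hε', ?_⟩
    rw [hdet, Complex.normSq_pos, Finset.prod_ne_zero_iff]
    intro j _
    have hε0 : (ε : ℂ) ≠ 0 := by exact_mod_cast (mem_Ioi.1 hε).ne'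
    simp [a, suslinExponent_ne_zero, hε0]
  · rw [← singularHomologyFunctor_map_eq_of_segment (f := suslinMap k ≫ θ ≫ sphereIncl k),
      Functor.map_comp, Functor.map_comp, h0, Limits.zero_comp, Limits.comp_zero]
    intro x t ht h
    rw [sphereIncl_orbit_suslinMap hθ] at h
    change _ + t • polyMap F x.1 = 0 at h
    rw [hF, ← map_smul, ← map_smul, ← map_add, (realCoords k).map_eq_zero_iff] at h
    set a := (realCoords k).symm x.1 with ha
    have ha0 : a ≠ 0 := by simpa [ha] using x.2
    obtain ⟨j, hj⟩ := Function.ne_iff.1 ha0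
    obtain ⟨c, -, hc, hcol⟩ := exists_suslin_col k ha0 j
    have hj' := congrFun h j
    simp only [Pi.add_apply, Pi.smul_apply, hcol, Complex.real_smul, Pi.zero_apply] at hj'
    have h2 : (((1 - t) * c + t : ℝ) : ℂ) * a j ^ suslinExponent k j = 0 := by
      rw [← hj']
      push_cast
      ring
    rcases mul_eq_zero.1 h2 with h3 | h3
    · have h4 : (1 - t) * c + t = 0 := by exact_mod_cast h3
      have hc0 := hc hj
      rcases ht.1.eq_or_lt with h5 | h5
      · subst h5
        linarith
      · nlinarith [mul_nonneg (sub_nonneg.2 ht.2) hc0.le]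
    · exact hj (eq_zero_of_pow_eq_zero h3)

end OrbitMapHomology

/-- the orbit map `θ_N : U(n) → S^{2n-1}`, `A ↦ A·e₁`, induces a nonzero map on
`(2n-1)`-st singular homology with real coefficients. -/
theorem U_orbitMap_nonzero_on_homology
    (n : ℕ) (hn : 1 ≤ n)
    (θ : TopCat.of (Matrix.unitaryGroup (Fin n) ℂ) ⟶
      TopCat.of (Metric.sphere (0 : EuclideanSpace ℂ (Fin n)) 1))
    (hθ : ∀ A : Matrix.unitaryGroup (Fin n) ℂ,
      Subtype.val (θ A) =
        (A : Matrix (Fin n) (Fin n) ℂ).mulVec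
          (EuclideanSpace.single (⟨0, by omega⟩ : Fin n) (1 : ℂ))) :
    (singularHomologyFunctor (2 * n - 1)).map θ ≠ 0 := by
  obtain ⟨k, rfl⟩ := Nat.exists_eq_add_of_le' hn
  exact OrbitMapHomology.singularHomologyFunctor_map_orbit_ne_zero hθ
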